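/- Let I ⊂ ℝ be a finite interval and let ϑ be the Riemann–Siegel theta branch. There is a constant C depending only on I such that for every s = σ + it with σ ∈ I and t ≥ 2π, and for all real α, β ≥ 1 with t = 2παβ, setting λ := √(α/β), one has |e^{iϑ(s)}ζ(s) − e^{iϑ(s)}·Σ_{n ≤ α} n^{−s} − e^{iϑ(1−s)}·Σ_{n ≤ β} n^{−(1−s)}| ≤ C·λ^{1/2−σ}·(λ^{1/2} + λ^{−1/2})·t^{−1/4}, where the sums run over positive integers n satisfying the stated inequality. -/

import Mathlib

open Complex Real MeasureTheory

noncomputable section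

def chi (s : ℂ) : ℂ := (π : ℂ) ^ (s - 1/2) * Complex.Gamma ((1 - s)/2) / Complex.Gamma (s/2)

def RSOmega : Set ℂ := {s : ℂ | s.im ≠ 0 ∨ (0 < s.re ∧ s.re < 1)}

def IsRSTheta (ϑ : ℂ → ℂ) : Prop :=
  DifferentiableOn ℂ ϑ RSOmega ∧ (∀ s ∈ RSOmega, Complex.exp (-2 * I * ϑ s) = chi s) ∧
    ϑ (1/2) = 0

def zetaSum (x : ℝ) (s : ℂ) : ℂ := ∑ n ∈ Finset.Icc 1 ⌊x⌋₊, (n : ℂ) ^ (-s)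

def Upsilon (u τ : ℂ) : ℂ :=
  ∫ v : ℝ, Complex.exp (3 * (π:ℂ) * I / 4) *
    (Complex.exp (-(π:ℂ) * I * τ * (1/2 + Complex.exp (3 * (π:ℂ) * I / 4) * v) ^ 2
        + 2 * (π:ℂ) * I * u * (1/2 + Complex.exp (3 * (π:ℂ) * I / 4) * v)) /
      (Complex.exp (2 * (π:ℂ) * I * (1/2 + Complex.exp (3 * (π:ℂ) * I / 4) * v)) - 1))

def G (u τ : ℂ) : ℂ :=
  τ ^ ((1:ℂ)/4) * Complex.exp (-(π:ℂ) * I * u ^ 2 / 2 + (π:ℂ) * I / 8) *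
    Upsilon (τ ^ ((1:ℂ)/2) * u) τ

def Gderiv (k : ℕ) (u τ : ℂ) : ℂ := iteratedDeriv k (fun w => G w τ) u

def hermiteH (n : ℕ) (x : ℂ) : ℂ :=
  (Nat.factorial n : ℂ) * ∑ j ∈ Finset.range (n / 2 + 1),
    (-1:ℂ) ^ j / ((Nat.factorial j : ℂ) * (Nat.factorial (n - 2*j) : ℂ)) * (2 * x) ^ (n - 2*j)

def obell (p : ℕ → ℂ) (i j : ℕ) : ℂ :=
  ∑ f ∈ (Finset.Nat.antidiagonalTuple j i).filter (fun f => ∀ l, 1 ≤ f l), ∏ l, p (f l)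

def bernoulliPoly (n : ℕ) (x : ℂ) : ℂ := Polynomial.aeval x (Polynomial.bernoulli n)

def fseq (σ : ℝ) (n : ℕ) : ℂ :=
  (bernoulliPoly (n+1) ((σ:ℂ)/2) + (-1:ℂ)^(n+1) * bernoulliPoly (n+1) ((1-(σ:ℂ))/2)) /
    (2*(n:ℂ)*((n:ℂ)+1))

def um (m : ℕ) (σ : ℝ) : ℂ :=
  (-2:ℂ)^m * ∑ k ∈ Finset.range (m+1), obell (fseq σ) m k / (Nat.factorial k : ℂ)

def seqA (j : ℕ) : ℂ := (-1:ℂ)^(j+1) / ((j:ℂ) + 2)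

def seqB (j : ℕ) : ℂ := (-1:ℂ)^(j+1) / (j:ℂ)

def dd (m r : ℕ) (σ : ℝ) : ℂ :=
  ∑ n ∈ Finset.Icc r m, (obell seqA n r / (Nat.factorial r : ℂ)) *
    ∑ k ∈ Finset.range (m - n + 1),
      (obell seqB (m - n) k / (Nat.factorial k : ℂ)) * ((σ:ℂ) - 1)^k

def qq (n ℓ : ℕ) (σ : ℝ) : ℂ :=
  ∑ m ∈ Finset.Icc (ℓ - n) (ℓ / 3), um m σ * dd (n - 2*m) (n + m - ℓ) σ

def PP (n k : ℕ) (x : ℂ) (σ : ℝ) : ℂ :=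
  Complex.exp (3 * (π:ℂ) * I * (k:ℂ) / 4) * ∑ ℓ ∈ Finset.range (k/2 + 1),
    (Nat.choose (3*n - 2*ℓ) (3*n - k) : ℂ) * (-1:ℂ)^(n + ℓ) * 2^(2*ℓ) / 2^k *
      qq n ℓ σ * hermiteH (k - 2*ℓ) (Complex.exp (-(π:ℂ) * I / 4) * x)

def IsAk (s : ℂ) (a : ℕ → ℂ) : Prop :=
  a 0 = 1 ∧ ∀ k : ℕ, ((k:ℂ) + 1) * (Real.sqrt s.im : ℂ) * a (k+1) =
    -((k:ℂ) + 1 - (s.re:ℂ)) * a k + I * (if 2 ≤ k then a (k-2) else 0)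

def IsPsi (Ψ : ℂ → ℂ) : Prop :=
  Differentiable ℂ Ψ ∧ ∀ u : ℂ, Complex.cos ((π:ℂ)*u) ≠ 0 →
    Ψ u = Complex.cos ((π:ℂ)*(u^2/2 - u - 1/8)) / Complex.cos ((π:ℂ)*u)

def wfun (s z : ℂ) : ℂ :=
  Complex.exp ((s - 1) * Complex.log (1 + z / (Real.sqrt s.im : ℂ))
    - I * (Real.sqrt s.im : ℂ) * z + I * z^2 / 2)

def rn (n : ℕ) (s z : ℂ) : ℂ :=
  wfun s z - ∑ k ∈ Finset.range n, (iteratedDeriv k (wfun s) 0 / (Nat.factorial k : ℂ)) * z^k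

def GammaOmega : Set ℂ := {s : ℂ | s.im ≠ 0 ∨ 0 < s.re}

def IsLogGamma (L : ℂ → ℂ) : Prop :=
  DifferentiableOn ℂ L GammaOmega ∧ (∀ s ∈ GammaOmega, Complex.exp (L s) = Complex.Gamma s) ∧
    L 1 = 0

def gseq (σ : ℝ) (n : ℕ) : ℂ := -(bernoulliPoly (n+1) (σ:ℂ)) / ((n:ℂ)*((n:ℂ)+1))

def gammam (m : ℕ) (σ : ℝ) : ℂ :=
  I^m * ∑ k ∈ Finset.range (m+1), obell (gseq σ) m k / (Nat.factorial k : ℂ)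


lemma Gamma_half_bound (t : ℝ) : ‖Complex.Gamma (1/2 + t * I)‖ ≤ √(2*π) * Real.exp (-(π/2) * |t|) := by
  have h := Complex.Gamma_mul_Gamma_one_sub (1/2 + t * I)
  have e : (1 - (1/2 + t * I) : ℂ) = (starRingEnd ℂ) (1/2 + t * I) := by
    apply Complex.ext <;> simp; norm_num
  rw [e, Complex.Gamma_conj, Complex.mul_conj] at h
  have h2 : Complex.sin (π * (1/2 + t * I)) = (Real.cosh (π * t) : ℂ) := by
    have : (π * (1/2 + t * I) : ℂ) = (π * t : ℂ) * I + π / 2 := by ring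
    rw [this, Complex.sin_add_pi_div_two, Complex.cos_mul_I]; push_cast; rfl
  rw [h2] at h
  have h3 : Complex.normSq (Complex.Gamma (1/2 + t * I)) = π / Real.cosh (π * t) := by
    exact_mod_cast h
  rw [Complex.normSq_eq_norm_sq] at h3
  have h4 : Real.exp (π * |t|) / 2 ≤ Real.cosh (π * t) := by
    rw [← Real.cosh_abs, abs_mul, abs_of_pos Real.pi_pos, Real.cosh_eq]
    have := Real.exp_pos (-(π * |t|))
    linarith
  have h5 : (√(2*π) * Real.exp (-(π/2) * |t|))^2 = 2 * π * Real.exp (-(π * |t|)) := by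
    rw [mul_pow, Real.sq_sqrt (by positivity), ← Real.exp_nat_mul]
    congr 2; push_cast; ring
  apply le_of_sq_le_sq _ (by positivity)
  rw [h3, h5, Real.exp_neg, div_le_iff₀ (Real.cosh_pos _)]
  have := Real.exp_pos (π * |t|)
  calc π = 2 * π * (Real.exp (π * |t|))⁻¹ * (Real.exp (π * |t|) / 2) := by field_simp
    _ ≤ _ := by gcongr

lemma norm_Gamma_le_real {s : ℂ} (hs : 0 < s.re) : ‖Complex.Gamma s‖ ≤ Real.Gamma s.re := by
  rw [Complex.Gamma_eq_integral hs, Real.Gamma_eq_integral hs, Complex.GammaIntegral]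
  refine (norm_integral_le_integral_norm _).trans (le_of_eq ?_)
  refine setIntegral_congr_fun measurableSet_Ioi fun x hx => ?_
  simp only [norm_mul, Complex.norm_cpow_eq_rpow_re_of_pos hx]
  rw [Complex.norm_of_nonneg (Real.exp_pos _).le]; simp

lemma arg_mul_le (s : ℂ) (hs : 0 < s.re) : s.im * Complex.arg s ≤ (π/2) * |s.im| := by
  have h1 := Complex.abs_arg_le_pi_div_two_iff.2 hs.le
  calc s.im * Complex.arg s ≤ |s.im * Complex.arg s| := le_abs_self _
    _ = |Complex.arg s| * |s.im| := by rw [abs_mul, mul_comm]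
    _ ≤ _ := by gcongr

lemma Gamma_strip {s : ℂ} (h1 : 1/2 ≤ s.re) (h2 : s.re ≤ 3/2) :
    ‖Complex.Gamma s * (s+1)^(1/2 - s)‖ ≤ √(2*π) := by
  have nrm : ∀ z : ℂ, 1/2 ≤ z.re → ‖Complex.Gamma z * (z+1)^(1/2 - z)‖ =
      ‖Complex.Gamma z‖ * ‖z+1‖^(1/2 - z.re) * Real.exp (z.im * Complex.arg (z+1)) := by
    intro z hz
    have hne : z + 1 ≠ 0 := by
      intro h; have := congrArg Complex.re h; simp at this; linarith
    rw [norm_mul, Complex.norm_cpow_of_ne_zero hne, div_eq_mul_inv, ← Real.exp_neg]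
    simp; ring_nf
  have earg : ∀ z : ℂ, 1/2 ≤ z.re → Real.exp (z.im * Complex.arg (z+1)) ≤ Real.exp ((π/2) * |z.im|) := by
    intro z hz
    apply Real.exp_le_exp.2
    have := arg_mul_le (z+1) (by simp; linarith)
    simpa using this
  have hd : ∀ z : ℂ, 1/2 ≤ z.re → DifferentiableAt ℂ (fun z => Complex.Gamma z * (z+1)^(1/2 - z)) z := by
    intro z hz
    refine DifferentiableAt.mul (Complex.differentiableAt_Gamma _ ?_) ?_
    · intro m h; have := congrArg Complex.re h; simp at this
      have : (0:ℝ) ≤ m := by positivity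
      linarith
    · refine DifferentiableAt.cpow (by fun_prop) (by fun_prop) ?_
      left; simp; linarith
  refine PhragmenLindelof.vertical_strip (a := 1/2) (b := 3/2)
    (f := fun z => Complex.Gamma z * (z+1)^(1/2 - z)) ?_ ?_ ?_ ?_ h1 h2
  · apply DifferentiableOn.diffContOnCl
    intro z hz
    have : z.re ∈ Set.Icc (1/2 : ℝ) (3/2) := by
      have := Complex.continuous_re.closure_preimage_subset _ hz
      rwa [closure_Ioo (by norm_num)] at this
    exact (hd z this.1).differentiableWithinAt
  · refine ⟨1, by norm_num; linarith [Real.pi_gt_three], π, ?_⟩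
    obtain ⟨C, hC⟩ := (isCompact_Icc (a := (1/2:ℝ)) (b := 3/2)).exists_bound_of_continuousOn
      (f := Real.Gamma) (fun x hx => (Real.differentiableAt_Gamma (fun m => by
        have : (0:ℝ) ≤ m := by positivity
        have := hx.1
        intro h; linarith)).continuousAt.continuousWithinAt)
    refine Asymptotics.IsBigO.of_bound C ?_
    refine Filter.eventually_inf_principal.2 (Filter.Eventually.of_forall fun z hz => ?_)
    have hz1 : 1/2 < z.re := hz.1
    have hz2 : z.re < 3/2 := hz.2
    rw [nrm z hz1.le]
    have a1 : ‖Complex.Gamma z‖ ≤ C :=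
      (norm_Gamma_le_real (by linarith)).trans ((le_abs_self _).trans (hC _ ⟨hz1.le, hz2.le⟩))
    have a2 : ‖z+1‖^(1/2 - z.re) ≤ 1 := by
      apply Real.rpow_le_one_of_one_le_of_nonpos _ (by linarith)
      have := Complex.re_le_norm (z+1)
      simp at this; linarith
    have a3 := earg z hz1.le
    have hC0 : 0 ≤ C := (norm_nonneg _).trans a1
    rw [Real.norm_of_nonneg (Real.exp_pos _).le]
    calc _ ≤ C * 1 * Real.exp ((π/2) * |z.im|) := by gcongr
      _ ≤ C * Real.exp (π * Real.exp (1 * |z.im|)) := by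
        rw [mul_one]
        gcongr
        · linarith [Real.pi_pos]
        · have := Real.add_one_le_exp (1 * |z.im|); linarith
  · intro z hz
    rw [nrm z hz.ge]
    have : z = 1/2 + z.im * I := by apply Complex.ext <;> simp [hz]
    have h := Gamma_half_bound z.im
    rw [← this] at h
    rw [hz]; simp only [sub_self, Real.rpow_zero, mul_one]
    calc _ ≤ (√(2*π) * Real.exp (-(π/2) * |z.im|)) * Real.exp ((π/2) * |z.im|) := by
          exact mul_le_mul h (earg z hz.ge) (Real.exp_pos _).le (by positivity)
      _ = √(2*π) := by rw [mul_assoc, ← Real.exp_add]; simp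
  · intro z hz
    rw [nrm z (by rw [hz]; norm_num)]
    have e : z = (1/2 + z.im * I) + 1 := by apply Complex.ext <;> simp [hz]; norm_num
    have hne : (1/2 + z.im * I : ℂ) ≠ 0 := by
      intro h; have := congrArg Complex.re h; simp at this
    have h := Gamma_half_bound z.im
    have h' : ‖Complex.Gamma z‖ ≤ ‖(1/2 + z.im * I : ℂ)‖ * (√(2*π) * Real.exp (-(π/2) * |z.im|)) := by
      have e2 : Complex.Gamma z = (1/2 + z.im * I) * Complex.Gamma (1/2 + z.im * I) := by
        rw [← Complex.Gamma_add_one _ hne, ← e]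
      rw [e2, norm_mul]
      exact mul_le_mul_of_nonneg_left h (norm_nonneg _)
    have h3 : ‖(1/2 + z.im * I : ℂ)‖ ≤ ‖z+1‖ := by
      rw [Complex.norm_eq_sqrt_sq_add_sq, Complex.norm_eq_sqrt_sq_add_sq]
      apply Real.sqrt_le_sqrt; simp [hz]; norm_num
    have hpos : 0 < ‖z+1‖ := lt_of_lt_of_le (norm_pos_iff.2 hne) h3
    rw [hz, show (1/2 - 3/2 : ℝ) = -1 by norm_num, Real.rpow_neg_one]
    calc _ ≤ (‖z+1‖ * (√(2*π) * Real.exp (-(π/2) * |z.im|))) * ‖z+1‖⁻¹ * Real.exp ((π/2) * |z.im|) := by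
          refine mul_le_mul ?_ (earg z (by rw [hz]; norm_num)) (Real.exp_pos _).le (by positivity)
          refine mul_le_mul_of_nonneg_right ?_ (by positivity)
          exact h'.trans (mul_le_mul_of_nonneg_right h3 (by positivity))
      _ = √(2*π) * (Real.exp (-(π/2) * |z.im|) * Real.exp ((π/2) * |z.im|)) := by field_simp
      _ = √(2*π) := by rw [← Real.exp_add]; simp

lemma arg_of_upper {w : ℂ} (h : 0 < w.im) : Complex.arg w = π/2 - Real.arctan (w.re / w.im) := by
  rw [Complex.arg_of_im_pos h, Real.arccos_eq_pi_div_two_sub_arcsin, Real.arctan_eq_arcsin]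
  have e : √(1 + (w.re / w.im)^2) = ‖w‖ / w.im := by
    rw [Complex.norm_eq_sqrt_sq_add_sq, ← Real.sqrt_sq h.le, ← Real.sqrt_div (by positivity), Real.sqrt_sq h.le]
    congr 1; field_simp; ring
  rw [e]
  congr 2
  field_simp

lemma arctan_le_self' {x : ℝ} (hx : 0 ≤ x) : Real.arctan x ≤ x := by
  have h := Real.le_tan (Real.arctan_nonneg.2 hx) (Real.arctan_lt_pi_div_two x)
  rwa [Real.tan_arctan] at h

lemma arg_lower {x t : ℝ} (hx : 0 < x) (ht : 0 < t) :
    π/2 * t - x ≤ t * Complex.arg (x + t * I) := by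
  have h : Complex.arg (x + t * I) = π/2 - Real.arctan (x / t) := by
    rw [arg_of_upper (by simpa using ht)]; simp
  rw [h]
  have : Real.arctan (x/t) ≤ x/t := arctan_le_self' (by positivity)
  have : t * Real.arctan (x/t) ≤ x := by
    calc _ ≤ t * (x/t) := by gcongr
      _ = x := by field_simp
  linarith

lemma rpow_ratio_bound {K x y r : ℝ} (hK : 1 ≤ K) (hx : 0 < x) (hy : 0 < y) (h1 : x ≤ K * y) (h2 : y ≤ K * x) :
    x ^ r ≤ K ^ |r| * y ^ r := by
  rcases le_total 0 r with h | h
  · rw [abs_of_nonneg h, ← Real.mul_rpow (by linarith) hy.le]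
    exact Real.rpow_le_rpow hx.le h1 h
  · rw [abs_of_nonpos h]
    have : y ^ (-r) ≤ (K * x) ^ (-r) := Real.rpow_le_rpow hy.le h2 (by linarith)
    rw [Real.mul_rpow (by linarith) hx.le, Real.rpow_neg hy.le, Real.rpow_neg hx.le] at this
    have hxr := Real.rpow_pos_of_pos hx r
    have hyr := Real.rpow_pos_of_pos hy r
    rw [← div_eq_mul_inv, le_div_iff₀ hxr, inv_mul_le_iff₀ hyr] at this
    linarith

lemma Gamma_upper_strip {s : ℂ} (h1 : 1/2 ≤ s.re) (h2 : s.re ≤ 3/2) (ht : 1 ≤ s.im) :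
    ‖Complex.Gamma s‖ ≤ (√(2*π) * 4 * Real.exp (5/2)) * s.im ^ (s.re - 1/2) * Real.exp (-(π/2) * s.im) := by
  have h := Gamma_strip h1 h2
  have hne : s + 1 ≠ 0 := by
    intro h; have := congrArg Complex.re h; simp at this; linarith
  rw [norm_mul, Complex.norm_cpow_of_ne_zero hne] at h
  have ha : π/2 * s.im - (s.re+1) ≤ s.im * Complex.arg (s+1) := by
    have := arg_lower (x := s.re + 1) (t := s.im) (by linarith) (by linarith)
    convert this using 3
    apply Complex.ext <;> simp
  have hp : 0 < ‖s+1‖ := norm_pos_iff.2 hne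
  have hb : ‖s+1‖ ≤ 4 * s.im := by
    have := Complex.norm_le_abs_re_add_abs_im (s+1)
    simp only [add_re, one_re, add_im, one_im, add_zero] at this
    rw [abs_of_pos (by linarith), abs_of_pos (by linarith)] at this
    linarith
  have hc : ‖s+1‖ ^ (s.re - 1/2) ≤ 4 * s.im ^ (s.re - 1/2) := by
    calc _ ≤ (4 * s.im) ^ (s.re - 1/2) := Real.rpow_le_rpow hp.le hb (by linarith)
      _ = 4 ^ (s.re - 1/2) * s.im ^ (s.re - 1/2) := Real.mul_rpow (by norm_num) (by linarith)
      _ ≤ 4 * s.im ^ (s.re - 1/2) := by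
        gcongr
        calc (4:ℝ) ^ (s.re - 1/2) ≤ 4 ^ (1:ℝ) := Real.rpow_le_rpow_of_exponent_le (by norm_num) (by linarith)
          _ = 4 := by simp
  have e1 : ((1/2 - s : ℂ)).re = -(s.re - 1/2) := by simp
  have e2 : ((1/2 - s : ℂ)).im = - s.im := by simp
  rw [e1, e2, Real.rpow_neg hp.le, mul_neg, Real.exp_neg, div_inv_eq_mul] at h
  have hq := Real.rpow_pos_of_pos hp (s.re - 1/2)
  have hE : Real.exp (π/2 * s.im - 5/2) ≤ Real.exp (Complex.arg (s+1) * s.im) := by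
    apply Real.exp_le_exp.2; rw [mul_comm (Complex.arg _)]; linarith
  have h3 : ‖Complex.Gamma s‖ * Real.exp (π/2 * s.im - 5/2) ≤ √(2*π) * ‖s+1‖ ^ (s.re - 1/2) := by
    calc _ ≤ ‖Complex.Gamma s‖ * Real.exp (Complex.arg (s+1) * s.im) := by gcongr
      _ = (‖Complex.Gamma s‖ * ((‖s+1‖ ^ (s.re - 1/2))⁻¹ * Real.exp (Complex.arg (s+1) * s.im))) * ‖s+1‖ ^ (s.re - 1/2) := by
        field_simp
      _ ≤ _ := by gcongr
  calc ‖Complex.Gamma s‖ = (‖Complex.Gamma s‖ * Real.exp (π/2 * s.im - 5/2)) * (Real.exp (5/2) * Real.exp (-(π/2) * s.im)) := by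
        rw [mul_assoc, ← Real.exp_add, ← Real.exp_add]
        ring_nf; simp
    _ ≤ (√(2*π) * (4 * s.im ^ (s.re - 1/2))) * (Real.exp (5/2) * Real.exp (-(π/2) * s.im)) := by
        refine mul_le_mul_of_nonneg_right (h3.trans (mul_le_mul_of_nonneg_left hc (by positivity))) (by positivity)
    _ = _ := by ring

lemma Gamma_upper_nat (n : ℕ) : ∃ C > 0, ∀ s : ℂ, 1/2 - n ≤ s.re → s.re ≤ 3/2 + n → 1 ≤ s.im →
    ‖Complex.Gamma s‖ ≤ C * s.im ^ (s.re - 1/2) * Real.exp (-(π/2) * s.im) := by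
  induction n with
  | zero => exact ⟨_, by positivity, fun s h1 h2 h3 => Gamma_upper_strip (by simpa using h1) (by simpa using h2) h3⟩
  | succ n ih =>
    obtain ⟨C, hC, ih⟩ := ih
    refine ⟨C * (n + 3), by positivity, fun s h1 h2 h3 => ?_⟩
    push_cast at h1 h2
    have hn : (0:ℝ) ≤ n := by positivity
    have hs0 : s ≠ 0 := by intro h; simp [h] at h3; linarith
    have hp : 0 < s.im := by linarith
    by_cases ha : s.re < 1/2 - n
    · have h := ih (s+1) (by simp; linarith) (by simp; linarith) (by simpa using h3)
      rw [Complex.Gamma_add_one _ hs0, norm_mul] at h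
      simp only [add_re, one_re, add_im, one_im, add_zero] at h
      have hs : s.im ≤ ‖s‖ := (le_abs_self _).trans (Complex.abs_im_le_norm s)
      rw [show s.re + 1 - 1/2 = (s.re - 1/2) + 1 by ring, Real.rpow_add_one hp.ne'] at h
      have : s.im * ‖Complex.Gamma s‖ ≤ s.im * (C * s.im ^ (s.re - 1/2) * Real.exp (-(π/2) * s.im)) := by
        calc _ ≤ ‖s‖ * ‖Complex.Gamma s‖ := by gcongr
          _ ≤ _ := h
          _ = _ := by ring
      have := le_of_mul_le_mul_left this hp
      refine this.trans ?_
      gcongr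
      nlinarith
    by_cases hb : s.re ≤ 3/2 + n
    · refine (ih s (by linarith) hb h3).trans ?_
      gcongr
      nlinarith
    · have h := ih (s-1) (by simp; linarith) (by simp; linarith) (by simpa using h3)
      have hs1 : s - 1 ≠ 0 := by
        intro h; have := congrArg Complex.im h; simp at this; linarith
      have e : Complex.Gamma s = (s-1) * Complex.Gamma (s-1) := by
        rw [← Complex.Gamma_add_one _ hs1]; simp
      simp only [sub_re, one_re, sub_im, one_im, sub_zero] at h
      have hn1 : ‖s-1‖ ≤ (n+3) * s.im := by
        have := Complex.norm_le_abs_re_add_abs_im (s-1)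
        simp only [sub_re, one_re, sub_im, one_im, sub_zero] at this
        rw [abs_of_pos (by linarith), abs_of_pos (by linarith)] at this
        nlinarith
      rw [e, norm_mul]
      calc _ ≤ ((n+3) * s.im) * (C * s.im ^ (s.re - 1 - 1/2) * Real.exp (-(π/2) * s.im)) := by gcongr
        _ = C * (n+3) * (s.im ^ (s.re - 1 - 1/2) * s.im) * Real.exp (-(π/2) * s.im) := by ring
        _ = _ := by rw [← Real.rpow_add_one hp.ne']; ring_nf

lemma Gamma_upper (A B : ℝ) : ∃ C > 0, ∀ s : ℂ, A ≤ s.re → s.re ≤ B → 1 ≤ s.im →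
    ‖Complex.Gamma s‖ ≤ C * s.im ^ (s.re - 1/2) * Real.exp (-(π/2) * s.im) := by
  obtain ⟨n, hn⟩ := exists_nat_ge (|A| + |B| + 1)
  obtain ⟨C, hC, h⟩ := Gamma_upper_nat n
  refine ⟨C, hC, fun s h1 h2 h3 => h s ?_ ?_ h3⟩
  · linarith [neg_abs_le A, abs_nonneg B]
  · linarith [le_abs_self B, abs_nonneg A]

lemma Gamma_lower (A B : ℝ) : ∃ C > 0, ∀ s : ℂ, A ≤ s.re → s.re ≤ B → 1 ≤ s.im →
    C * s.im ^ (s.re - 1/2) * Real.exp (-(π/2) * s.im) ≤ ‖Complex.Gamma s‖ := by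
  obtain ⟨C, hC, h⟩ := Gamma_upper (1-B) (1-A)
  refine ⟨C⁻¹, by positivity, fun s h1 h2 h3 => ?_⟩
  have hp : 0 < s.im := by linarith
  have hr := Complex.Gamma_mul_Gamma_one_sub s
  have e : (1 - s) = (starRingEnd ℂ) (1 - (starRingEnd ℂ) s) := by simp
  rw [e, Complex.Gamma_conj] at hr
  have hr2 := congrArg norm hr
  rw [norm_mul, RCLike.norm_conj, norm_div, Complex.norm_of_nonneg Real.pi_pos.le] at hr2
  have hu := h (1 - (starRingEnd ℂ) s) (by simp; linarith) (by simp; linarith) (by simpa using h3)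
  simp only [sub_re, one_re, conj_re, sub_im, one_im, conj_im, zero_sub, neg_neg] at hu
  have hsin : ‖Complex.sin (π * s)‖ ≤ Real.exp (π * s.im) := by
    rw [Complex.sin]
    rw [norm_div, norm_mul]
    simp only [norm_I, mul_one, Complex.norm_ofNat]
    have a1 := norm_sub_le (Complex.exp (-(π * s) * I)) (Complex.exp (π * s * I))
    rw [Complex.norm_exp, Complex.norm_exp] at a1
    simp at a1
    rw [neg_mul]
    have : Real.exp (-(π * s.im)) ≤ Real.exp (π * s.im) := Real.exp_le_exp.2 (by nlinarith [Real.pi_pos])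
    linarith
  have hsne : Complex.sin (π * s) ≠ 0 := by
    intro h0
    rw [Complex.sin_eq_zero_iff] at h0
    obtain ⟨k, hk⟩ := h0
    have := congrArg Complex.im hk
    simp [Real.pi_ne_zero] at this
    linarith
  have hsp : 0 < ‖Complex.sin (π * s)‖ := norm_pos_iff.2 hsne
  have h5 : Real.exp (-(π * s.im)) ≤ π / ‖Complex.sin (π * s)‖ := by
    rw [Real.exp_neg, inv_eq_one_div]
    exact div_le_div₀ Real.pi_pos.le (by linarith [Real.pi_gt_three]) hsp hsin
  rw [← hr2] at h5
  have h6 : Real.exp (-(π * s.im)) ≤ ‖Complex.Gamma s‖ * (C * s.im ^ (1 - s.re - 1/2) * Real.exp (-(π/2) * s.im)) :=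
    h5.trans (by gcongr)
  have e7 : s.im ^ (1 - s.re - 1/2) = (s.im ^ (s.re - 1/2))⁻¹ := by
    rw [← Real.rpow_neg hp.le]; congr 1; ring
  have e8 : Real.exp (-(π * s.im)) = Real.exp (-(π/2) * s.im) * Real.exp (-(π/2) * s.im) := by
    rw [← Real.exp_add]; ring_nf
  rw [e7, e8] at h6
  have hX := Real.rpow_pos_of_pos hp (s.re - 1/2)
  have hE := Real.exp_pos (-(π/2) * s.im)
  have h9 : Real.exp (-(π/2) * s.im) ≤ ‖Complex.Gamma s‖ * (C * (s.im ^ (s.re - 1/2))⁻¹) := by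
    refine le_of_mul_le_mul_right (h6.trans (le_of_eq (by ring))) hE
  calc _ ≤ C⁻¹ * s.im ^ (s.re - 1/2) * (‖Complex.Gamma s‖ * (C * (s.im ^ (s.re - 1/2))⁻¹)) := by gcongr
    _ = _ := by field_simp



def KK (m : ℕ) (w : ℂ) : ℂ := Complex.exp (-(m:ℂ) * w) / (Complex.exp w - 1)

lemma KK_diff (m : ℕ) {w : ℂ} (h : Complex.exp w ≠ 1) : DifferentiableAt ℂ (KK m) w := by
  unfold KK
  refine DifferentiableAt.div (by fun_prop) (by fun_prop) (sub_ne_zero.2 h)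

lemma exp_ne_one_of_im {w : ℂ} (h0 : w ≠ 0) (h : |w.im| < 2 * π) : Complex.exp w ≠ 1 := by
  intro h1
  obtain ⟨n, hn⟩ := Complex.exp_eq_one_iff.1 h1
  have him : w.im = n * (2 * π) := by rw [hn]; simp
  rw [him, abs_mul, abs_of_pos (by positivity : 0 < 2 * π)] at h
  have : |(n:ℝ)| < 1 := by
    by_contra hc; push Not at hc
    nlinarith [Real.pi_pos]
  have hn0 : n = 0 := by
    have h2 : |n| < 1 := by exact_mod_cast this
    exact Int.abs_lt_one_iff.1 h2
  rw [hn0] at hn; simp at hn; exact h0 hn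

lemma exp_ne_one_of_norm {w : ℂ} (h0 : w ≠ 0) (h : ‖w‖ ≤ 1) : Complex.exp w ≠ 1 :=
  exp_ne_one_of_im h0 ((Complex.abs_im_le_norm w).trans_lt (by linarith [Real.pi_gt_three]))

lemma exp_ne_one_of_re {w : ℂ} (h : w.re ≠ 0) : Complex.exp w ≠ 1 := by
  intro h1
  obtain ⟨n, hn⟩ := Complex.exp_eq_one_iff.1 h1
  apply h; rw [hn]; simp

lemma norm_KK_real (m : ℕ) {x : ℝ} (hx : 0 < x) : ‖KK m x‖ = Real.exp (-(m:ℝ) * x) / (Real.exp x - 1) := by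
  unfold KK
  have h1 : 1 < Real.exp x := Real.one_lt_exp_iff.2 hx
  have : Complex.exp (-(m:ℂ) * x) / (Complex.exp x - 1) = ((Real.exp (-(m:ℝ) * x) / (Real.exp x - 1) : ℝ) : ℂ) := by
    push_cast; rfl
  rw [this, Complex.norm_of_nonneg]
  have := Real.exp_pos (-(m:ℝ) * x)
  exact div_nonneg this.le (by linarith)

lemma norm_KK_real_le (m : ℕ) {x : ℝ} (hx : 0 < x) : ‖KK m x‖ ≤ x⁻¹ := by
  rw [norm_KK_real m hx, inv_eq_one_div]
  apply div_le_div₀ zero_le_one _ hx _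
  · apply Real.exp_le_one_iff.2
    have : (0:ℝ) ≤ m * x := by positivity
    linarith
  · have := Real.add_one_le_exp x; linarith

lemma norm_KK_real_le' (m : ℕ) {x : ℝ} (hx : 1 ≤ x) : ‖KK m x‖ ≤ 2 * Real.exp (-1 * x) := by
  rw [norm_KK_real m (by linarith)]
  have h1 := Real.add_one_le_exp x
  rw [div_le_iff₀ (by linarith)]
  have h2 : Real.exp (-(m:ℝ) * x) ≤ 1 := by
    apply Real.exp_le_one_iff.2
    have : (0:ℝ) ≤ m * x := by positivity
    linarith
  have h3 : Real.exp (-1 * x) * Real.exp x = 1 := by rw [← Real.exp_add]; simp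
  have h4 : Real.exp (-1 * x) ≤ 1/2 := by
    have := Real.exp_pos (-1*x)
    nlinarith
  nlinarith

lemma KK_contOn (m : ℕ) : ContinuousOn (fun x : ℝ => KK m x) (Set.Ioi 0) := by
  intro x hx
  have : ContinuousAt (KK m) (x:ℂ) := (KK_diff m (exp_ne_one_of_re (by simpa using (ne_of_gt hx)))).continuousAt
  exact (ContinuousAt.comp (f := fun x : ℝ => (x:ℂ)) this Complex.continuous_ofReal.continuousAt).continuousWithinAt

lemma KK_mellinConv (m : ℕ) {s : ℂ} (hs : 1 < s.re) : MellinConvergent (fun x : ℝ => KK m x) s := by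
  refine mellinConvergent_of_isBigO_rpow_exp (a := 1) (b := 1) one_pos
    ((KK_contOn m).locallyIntegrableOn measurableSet_Ioi) ?_ ?_ hs
  · refine Asymptotics.IsBigO.of_bound 2 ?_
    filter_upwards [Filter.eventually_ge_atTop 1] with x hx
    rw [Real.norm_of_nonneg (Real.exp_pos _).le]
    exact norm_KK_real_le' m hx
  · refine Asymptotics.IsBigO.of_bound 1 ?_
    filter_upwards [self_mem_nhdsWithin] with x hx
    have hx' : 0 < x := hx
    rw [Real.rpow_neg_one, Real.norm_of_nonneg (by positivity), one_mul]
    exact norm_KK_real_le m hx'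

lemma KK_mellin (m : ℕ) {s : ℂ} (hs : 1 < s.re) : mellin (fun x : ℝ => KK m x) s =
    Complex.Gamma s * (riemannZeta s - ∑ n ∈ Finset.Icc 1 m, (n:ℂ) ^ (-s)) := by
  have h := hasSum_mellin (a := fun _ : ℕ => (1:ℂ)) (p := fun n : ℕ => (n:ℝ) + m + 1)
    (F := fun x : ℝ => KK m x) (s := s) (fun i => Or.inr (by positivity)) (by linarith) ?_ ?_
  · have hz : Summable fun n : ℕ => 1 / ((n:ℂ) + 1) ^ s := by
      have := (Complex.summable_one_div_nat_cpow (p := s)).2 hs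
      have h2 := (summable_nat_add_iff 1).2 this
      exact_mod_cast h2
    have h2 := hz.sum_add_tsum_nat_add m
    rw [← zeta_eq_tsum_one_div_nat_add_one_cpow hs] at h2
    rw [← h.tsum_eq, ← h2]
    have h3 : ∑ n ∈ Finset.Icc 1 m, (n:ℂ) ^ (-s) = ∑ i ∈ Finset.range m, 1 / ((i:ℂ) + 1) ^ s := by
      clear h h2 hz
      induction m with
      | zero => simp
      | succ k ih =>
        rw [Finset.sum_Icc_succ_top (by omega), Finset.sum_range_succ, ih, Complex.cpow_neg, one_div]
        push_cast; rfl
    rw [h3, add_sub_cancel_left, ← tsum_mul_left]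
    refine tsum_congr fun n => ?_
    push_cast
    rw [mul_one, mul_one_div]
  · intro t ht
    have ht' : 0 < t := ht
    have hlt : ‖(Real.exp (-t) : ℂ)‖ < 1 := by
      rw [Complex.norm_of_nonneg (Real.exp_pos _).le]; rw [← Real.exp_zero]; exact Real.exp_lt_exp.2 (by linarith)
    have hg := (hasSum_geometric_of_norm_lt_one hlt).mul_left ((Real.exp (-((m:ℝ)+1) * t) : ℝ) : ℂ)
    have ea : (fun i : ℕ => (1:ℂ) * ((Real.exp (-((i:ℝ) + m + 1) * t) : ℝ) : ℂ)) =
        fun i : ℕ => ((Real.exp (-((m:ℝ)+1) * t) : ℝ) : ℂ) * ((Real.exp (-t) : ℝ) : ℂ) ^ i := by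
      funext n
      rw [one_mul, ← Complex.ofReal_pow, ← Complex.ofReal_mul]
      rw [← Real.exp_nat_mul, ← Real.exp_add]; congr 2; ring
    have eb : KK m t = ((Real.exp (-((m:ℝ)+1) * t) : ℝ) : ℂ) * (1 - ((Real.exp (-t) : ℝ) : ℂ))⁻¹ := by
      unfold KK
      have e1 : Complex.exp t ≠ 0 := Complex.exp_ne_zero _
      have e2 : Complex.exp (t:ℂ) - 1 ≠ 0 := sub_ne_zero.2 (exp_ne_one_of_re (by simpa using ht'.ne'))
      push_cast
      rw [show (-((m:ℂ)+1) * t) = -(m:ℂ) * t + -t by ring, Complex.exp_add, Complex.exp_neg (t:ℂ)]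
      have e3 : 1 - (Complex.exp t)⁻¹ ≠ 0 := by
        intro h; apply e2; field_simp at h; rw [h, mul_zero]
      field_simp
    rw [ea, eb]
    exact hg
  · have := (Real.summable_one_div_nat_rpow (p := s.re)).2 hs
    have h2 := (summable_nat_add_iff (m+1)).2 this
    refine h2.congr fun n => ?_
    push_cast; simp [add_assoc]

def circI (m : ℕ) (s : ℂ) : ℂ := I * ∫ θ in (0:ℝ)..(2*π), Complex.exp (s * (θ * I)) * KK m (Complex.exp (θ * I))

lemma KK_circ_cont (m : ℕ) : Continuous fun θ : ℝ => KK m (Complex.exp (θ * I)) := by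
  rw [continuous_iff_continuousAt]
  intro θ
  have h1 : ContinuousAt (KK m) (Complex.exp (θ * I)) :=
    (KK_diff m (exp_ne_one_of_norm (Complex.exp_ne_zero _) (by rw [Complex.norm_exp_ofReal_mul_I]))).continuousAt
  exact ContinuousAt.comp (f := fun θ : ℝ => Complex.exp (θ * I)) h1 (by fun_prop)

lemma circI_diff (m : ℕ) (s : ℂ) : DifferentiableAt ℂ (circI m) s := by
  unfold circI
  refine DifferentiableAt.const_mul ?_ _
  have hk := KK_circ_cont m
  have := (intervalIntegral.hasDerivAt_integral_of_dominated_loc_of_deriv_le (𝕜 := ℂ) (μ := volume) (a := 0) (b := 2*π)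
    (F := fun s θ => Complex.exp (s * (θ * I)) * KK m (Complex.exp (θ * I)))
    (F' := fun s θ => Complex.exp (s * (θ * I)) * (θ * I) * KK m (Complex.exp (θ * I)))
    (bound := fun θ => Real.exp ((‖s‖+1) * (2*π)) * (2*π) * ‖KK m (Complex.exp (θ * I))‖)
    (x₀ := s) (Metric.ball_mem_nhds s one_pos) ?_ ?_ ?_ ?_ ?_ ?_).2
  · exact this.differentiableAt
  · refine Filter.Eventually.of_forall fun z => ?_
    exact (Continuous.mul (by fun_prop) hk).aestronglyMeasurable
  · exact (Continuous.mul (by fun_prop) hk).intervalIntegrable _ _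
  · exact (Continuous.mul (by fun_prop) hk).aestronglyMeasurable
  · refine Filter.Eventually.of_forall fun θ hθ z hz => ?_
    rw [Set.uIoc_of_le (by positivity)] at hθ
    rw [norm_mul, norm_mul]
    have h1 : ‖(θ * I : ℂ)‖ = θ := by simp [abs_of_pos hθ.1]
    have h2 : ‖z‖ ≤ ‖s‖ + 1 := by
      have : ‖z - s‖ < 1 := by simpa [dist_eq_norm] using hz
      have := norm_le_norm_add_norm_sub' z s
      linarith
    gcongr
    · refine (Complex.norm_exp_le_exp_norm _).trans (Real.exp_le_exp.2 ?_)
      rw [norm_mul, h1]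
      have := hθ.2; have := hθ.1
      gcongr
    · rw [h1]; exact hθ.2
  · exact (Continuous.mul (by fun_prop) hk.norm).intervalIntegrable _ _
  · refine Filter.Eventually.of_forall fun θ hθ z hz => ?_
    refine HasDerivAt.mul_const ?_ _
    have h : HasDerivAt (fun z : ℂ => z * (θ * I)) (θ * I) z := hasDerivAt_mul_const _
    exact h.cexp

def tailI (m : ℕ) (s : ℂ) : ℂ := ∫ x in Set.Ioi (1:ℝ), (x:ℂ) ^ (s-1) * KK m x

lemma tailI_mellin (m : ℕ) (s : ℂ) : tailI m s = mellin (Set.indicator (Set.Ioi (1:ℝ)) (fun x : ℝ => KK m x)) s := by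
  unfold tailI mellin
  have : ∀ t : ℝ, (t:ℂ)^(s-1) • Set.indicator (Set.Ioi (1:ℝ)) (fun x : ℝ => KK m x) t
      = Set.indicator (Set.Ioi (1:ℝ)) (fun x : ℝ => (x:ℂ)^(s-1) * KK m x) t := by
    intro t
    by_cases h : t ∈ Set.Ioi (1:ℝ) <;> simp [Set.indicator, h]
  simp_rw [this]
  rw [setIntegral_indicator measurableSet_Ioi]
  congr 2
  ext x; simp only [Set.mem_inter_iff, Set.mem_Ioi]; exact ⟨fun h => ⟨by linarith, h⟩, fun h => h.2⟩

lemma tail_hyp (m : ℕ) : LocallyIntegrableOn (Set.indicator (Set.Ioi (1:ℝ)) (fun x : ℝ => KK m x)) (Set.Ioi 0) ∧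
   ((Set.indicator (Set.Ioi (1:ℝ)) (fun x : ℝ => KK m x)) =O[Filter.atTop] fun t => Real.exp (-1 * t)) ∧
   ∀ b : ℝ, (Set.indicator (Set.Ioi (1:ℝ)) (fun x : ℝ => KK m x)) =O[nhdsWithin 0 (Set.Ioi 0)] fun x => x ^ (-b) := by
  refine ⟨?_, ?_, fun b => ?_⟩
  · have h := (KK_contOn m).locallyIntegrableOn (μ := volume) measurableSet_Ioi
    intro x hx
    obtain ⟨u, hu, hi⟩ := h x hx
    exact ⟨u, hu, hi.indicator measurableSet_Ioi⟩
  · refine Asymptotics.IsBigO.of_bound 2 ?_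
    filter_upwards [Filter.eventually_gt_atTop 1] with x hx
    rw [Real.norm_of_nonneg (Real.exp_pos _).le, Set.indicator_of_mem (by exact hx)]
    exact norm_KK_real_le' m (by linarith)
  · refine Asymptotics.IsBigO.of_bound 1 ?_
    have : Set.Iio (1:ℝ) ∈ nhdsWithin (0:ℝ) (Set.Ioi 0) := mem_nhdsWithin_of_mem_nhds (Iio_mem_nhds one_pos)
    filter_upwards [this] with x hx
    rw [Set.indicator_of_notMem (by simpa using le_of_lt hx)]
    simp

lemma tailI_diff (m : ℕ) (s : ℂ) : DifferentiableAt ℂ (tailI m) s := by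
  have e : tailI m = mellin (Set.indicator (Set.Ioi (1:ℝ)) (fun x : ℝ => KK m x)) := funext (tailI_mellin m)
  rw [e]
  obtain ⟨h1, h2, h3⟩ := tail_hyp m
  exact mellin_differentiableAt_of_isBigO_rpow_exp one_pos h1 h2 (h3 (s.re - 1)) (by linarith)

lemma tail_integrable (m : ℕ) (s : ℂ) : IntegrableOn (fun x : ℝ => (x:ℂ) ^ (s-1) * KK m x) (Set.Ioi 1) := by
  obtain ⟨h1, h2, h3⟩ := tail_hyp m
  have h := mellinConvergent_of_isBigO_rpow_exp one_pos h1 h2 (h3 (s.re - 1)) (s := s) (by linarith)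
  unfold MellinConvergent at h
  have h' := h.mono_set (Set.Ioi_subset_Ioi zero_le_one)
  refine h'.congr_fun (fun x hx => ?_) measurableSet_Ioi
  simp only [smul_eq_mul]
  rw [Set.indicator_of_mem hx]



lemma norm_exp_sub_one_ge {w : ℂ} (h : ‖w‖ ≤ 1/2) : ‖w‖ / 2 ≤ ‖Complex.exp w - 1‖ := by
  have h1 := Complex.norm_exp_sub_one_sub_id_le (x := w) (by linarith)
  have h2 : ‖w‖ ≤ ‖Complex.exp w - 1‖ + ‖Complex.exp w - 1 - w‖ := by
    have := norm_sub_le (Complex.exp w - 1) (Complex.exp w - 1 - w)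
    simpa using this
  nlinarith [norm_nonneg w]

lemma norm_KK_small (m : ℕ) {w : ℂ} (h0 : w ≠ 0) (h : ‖w‖ ≤ 1/2) : ‖KK m w‖ ≤ Real.exp m * (2 / ‖w‖) := by
  unfold KK
  have hp : 0 < ‖w‖ := norm_pos_iff.2 h0
  have h1 := norm_exp_sub_one_ge h
  rw [norm_div, div_eq_mul_inv]
  gcongr
  · refine (Complex.norm_exp_le_exp_norm _).trans (Real.exp_le_exp.2 ?_)
    rw [norm_mul, norm_neg, Complex.norm_natCast]
    nlinarith [(Nat.cast_nonneg m : (0:ℝ) ≤ m)]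
  · rw [show 2 / ‖w‖ = (‖w‖/2)⁻¹ by field_simp]
    gcongr

def HH (m : ℕ) (s u : ℂ) : ℂ := Complex.exp (s * u) * KK m (Complex.exp u)

lemma rect_id (m : ℕ) (s : ℂ) {R : ℝ} (hR : 0 ≤ R) :
    (1 - Complex.exp (2 * π * I * s)) * (∫ x in (Real.exp (-R))..1, (x:ℂ)^(s-1) * KK m x) + circI m s
      = I * ∫ θ in (0:ℝ)..(2*π), HH m s ((-R : ℝ) + θ * I) := by
  have hd : DifferentiableOn ℂ (HH m s) (Set.uIcc ((-R:ℝ):ℂ).re ((2 * π : ℝ) * I : ℂ).re ×ℂ Set.uIcc ((-R:ℝ):ℂ).im ((2 * π : ℝ) * I : ℂ).im) := by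
    intro u hu
    have hu1 := hu.1
    simp only [Set.mem_preimage, ofReal_re, mul_re, I_re, mul_zero, ofReal_im, I_im, zero_mul, sub_zero] at hu1
    rw [Set.uIcc_of_le (by linarith)] at hu1
    have hk : DifferentiableAt ℂ (KK m) (Complex.exp u) := by
      apply KK_diff
      apply exp_ne_one_of_norm (Complex.exp_ne_zero _)
      rw [Complex.norm_exp]; exact Real.exp_le_one_iff.2 hu1.2
    unfold HH
    refine DifferentiableAt.differentiableWithinAt ?_
    refine DifferentiableAt.mul (by fun_prop) ?_
    exact DifferentiableAt.comp u hk (by fun_prop)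
  have h := Complex.integral_boundary_rect_eq_zero_of_differentiableOn _ _ _ hd
  simp only [ofReal_re, mul_re, I_re, mul_zero, ofReal_im, I_im, zero_mul, sub_zero, mul_im, mul_one, add_zero, smul_eq_mul,
    ofReal_zero, zero_add] at h
  have e1 : ∀ x : ℝ, HH m s (x + (2*π : ℝ) * I) = Complex.exp (2 * π * I * s) * HH m s x := by
    intro x
    unfold HH
    rw [Complex.exp_add (x:ℂ)]
    push_cast
    rw [Complex.exp_two_pi_mul_I, mul_one, ← mul_assoc, ← Complex.exp_add]
    congr 2; ring
  have e2 : (∫ x in (-R)..0, HH m s x) = ∫ x in (Real.exp (-R))..1, (x:ℂ)^(s-1) * KK m x := by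
    have := intervalIntegral.integral_deriv_smul_comp' (a := -R) (b := 0) (f := Real.exp) (f' := Real.exp)
      (g := fun x : ℝ => (x:ℂ)^(s-1) * KK m x) (fun x _ => Real.hasDerivAt_exp x) Real.continuous_exp.continuousOn ?_
    · rw [Real.exp_zero] at this
      rw [← this]
      refine intervalIntegral.integral_congr fun x _ => ?_
      simp only [HH, Function.comp, Complex.real_smul]
      rw [Complex.cpow_def_of_ne_zero (by exact_mod_cast (Real.exp_pos x).ne'), ← Complex.ofReal_log (Real.exp_pos x).le,
        Real.log_exp, Complex.ofReal_exp, ← mul_assoc, ← Complex.exp_add]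
      congr 2; ring
    · have hsub : Real.exp '' Set.uIcc (-R) 0 ⊆ Set.Ioi 0 := by
        rintro _ ⟨x, _, rfl⟩; exact Real.exp_pos x
      refine ContinuousOn.mul ?_ ((KK_contOn m).mono hsub)
      intro x hx
      have hx0 : 0 < x := hsub hx
      exact (Complex.continuousAt_ofReal_cpow_const x (s-1) (Or.inr hx0.ne')).continuousWithinAt
  simp_rw [e1] at h
  rw [intervalIntegral.integral_const_mul, e2] at h
  have e3 : circI m s = I * ∫ y in (0:ℝ)..(2*π), HH m s (y * I) := rfl
  rw [e3, ← sub_eq_zero]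
  rw [← h]
  ring

lemma left_bound (m : ℕ) (s : ℂ) {R : ℝ} (hR : 1 ≤ R) (ht : 0 < s.im) :
    ‖I * ∫ θ in (0:ℝ)..(2*π), HH m s ((-R : ℝ) + θ * I)‖ ≤ (2 * Real.exp m * Real.exp ((1 - s.re) * R)) * |2*π - 0| := by
  rw [norm_mul, norm_I, one_mul]
  refine intervalIntegral.norm_integral_le_of_norm_le_const fun θ hθ => ?_
  rw [Set.uIoc_of_le (by positivity)] at hθ
  unfold HH
  rw [norm_mul]
  have hn : ‖Complex.exp ((-R:ℝ) + θ * I)‖ = Real.exp (-R) := by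
    rw [Complex.norm_exp]; simp
  have h12 : Real.exp (-R) ≤ 1/2 := by
    have h2 : 2 ≤ Real.exp R := by have := Real.add_one_le_exp R; linarith
    rw [Real.exp_neg, inv_eq_one_div]
    exact div_le_div_of_nonneg_left (by norm_num) (by norm_num) h2
  have h1 := norm_KK_small m (Complex.exp_ne_zero ((-R:ℝ) + θ * I)) (by rw [hn]; exact h12)
  rw [hn] at h1
  have h2 : ‖Complex.exp (s * ((-R:ℝ) + θ * I))‖ ≤ Real.exp (-(s.re * R)) := by
    rw [Complex.norm_exp]
    apply Real.exp_le_exp.2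
    simp
    have := mul_pos ht hθ.1
    linarith
  calc _ ≤ Real.exp (-(s.re * R)) * (Real.exp m * (2 / Real.exp (-R))) := by gcongr
    _ = 2 * Real.exp m * (Real.exp (-(s.re * R)) * Real.exp R) := by rw [Real.exp_neg R]; field_simp
    _ = _ := by rw [← Real.exp_add]; ring_nf

lemma exp_two_pi_ne {s : ℂ} (ht : 0 < s.im) : Complex.exp (2 * π * I * s) - 1 ≠ 0 := by
  apply sub_ne_zero.2
  apply exp_ne_one_of_re
  simp
  exact ht.ne'

lemma hankel_gt (m : ℕ) {s : ℂ} (hs : 1 < s.re) (ht : 0 < s.im) :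
    Complex.Gamma s * (riemannZeta s - ∑ n ∈ Finset.Icc 1 m, (n:ℂ) ^ (-s)) =
      tailI m s + circI m s / (Complex.exp (2 * π * I * s) - 1) := by
  have hc := KK_mellinConv m hs
  rw [← KK_mellin m hs]
  unfold MellinConvergent at hc
  replace hc : IntegrableOn (fun x : ℝ => (x:ℂ)^(s-1) * KK m x) (Set.Ioi 0) := hc
  have hsplit : mellin (fun x : ℝ => KK m x) s = (∫ x in (0:ℝ)..1, (x:ℂ)^(s-1) * KK m x) + tailI m s := by
    unfold mellin tailI
    simp only [smul_eq_mul]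
    rw [intervalIntegral.integral_of_le zero_le_one, ← setIntegral_union (Set.Ioc_disjoint_Ioi le_rfl) measurableSet_Ioi
      (hc.mono_set Set.Ioc_subset_Ioi_self) (hc.mono_set (Set.Ioi_subset_Ioi zero_le_one)), Set.Ioc_union_Ioi_eq_Ioi zero_le_one]
  have hlim1 : Filter.Tendsto (fun R : ℝ => ∫ x in (Real.exp (-R))..1, (x:ℂ)^(s-1) * KK m x) Filter.atTop
      (nhds (∫ x in (0:ℝ)..1, (x:ℂ)^(s-1) * KK m x)) := by
    have hI : IntegrableOn (fun x : ℝ => (x:ℂ)^(s-1) * KK m x) (Set.uIcc 0 1) := by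
      rw [Set.uIcc_of_le zero_le_one, integrableOn_Icc_iff_integrableOn_Ioc]
      exact hc.mono_set Set.Ioc_subset_Ioi_self
    have hco := intervalIntegral.continuousOn_primitive_interval_left hI 0 (by simp)
    refine Filter.Tendsto.comp (g := fun y : ℝ => ∫ x in y..1, (x:ℂ)^(s-1) * KK m x) (y := nhdsWithin 0 (Set.uIcc 0 1)) hco ?_
    refine tendsto_nhdsWithin_iff.2 ⟨?_, ?_⟩
    · exact Real.tendsto_exp_neg_atTop_nhds_zero
    · filter_upwards [Filter.eventually_ge_atTop 0] with R hR
      rw [Set.uIcc_of_le zero_le_one]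
      exact ⟨(Real.exp_pos _).le, Real.exp_le_one_iff.2 (by linarith)⟩
  have hlim2 : Filter.Tendsto (fun R : ℝ => I * ∫ θ in (0:ℝ)..(2*π), HH m s ((-R : ℝ) + θ * I)) Filter.atTop (nhds 0) := by
    refine squeeze_zero_norm' (a := fun R : ℝ => (2 * Real.exp m * Real.exp ((1 - s.re) * R)) * |2*π - 0|) ?_ ?_
    · filter_upwards [Filter.eventually_ge_atTop 1] with R hR
      exact left_bound m s hR ht
    · have h0 : Filter.Tendsto (fun R : ℝ => Real.exp ((1 - s.re) * R)) Filter.atTop (nhds 0) := by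
        refine Real.tendsto_exp_atBot.comp ?_
        exact Filter.tendsto_id.const_mul_atTop_of_neg (by linarith)
      have := (h0.const_mul (2 * Real.exp m)).mul_const |2*π - 0|
      simpa using this
  have hlim3 := (hlim1.const_mul (1 - Complex.exp (2 * π * I * s))).add_const (circI m s)
  have hlim3' := hlim3.congr' (f₂ := fun R : ℝ => I * ∫ θ in (0:ℝ)..(2*π), HH m s ((-R : ℝ) + θ * I)) (by
    filter_upwards [Filter.eventually_ge_atTop 0] with R hR
    exact rect_id m s hR)
  have hfin := tendsto_nhds_unique hlim3' hlim2
  rw [hsplit]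
  have hne := exp_two_pi_ne ht
  have : (∫ x in (0:ℝ)..1, (x:ℂ)^(s-1) * KK m x) = circI m s / (Complex.exp (2 * π * I * s) - 1) := by
    rw [eq_div_iff hne]
    linear_combination -hfin
  rw [this]; ring

lemma hankel (m : ℕ) {s : ℂ} (ht : 0 < s.im) :
    Complex.Gamma s * (riemannZeta s - ∑ n ∈ Finset.Icc 1 m, (n:ℂ) ^ (-s)) =
      tailI m s + circI m s / (Complex.exp (2 * π * I * s) - 1) := by
  have hop : IsOpen {s : ℂ | 0 < s.im} := isOpen_lt continuous_const Complex.continuous_im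
  have ha : AnalyticOnNhd ℂ (fun s => Complex.Gamma s * (riemannZeta s - ∑ n ∈ Finset.Icc 1 m, (n:ℂ) ^ (-s))) {s : ℂ | 0 < s.im} := by
    refine DifferentiableOn.analyticOnNhd (fun z hz => DifferentiableAt.differentiableWithinAt ?_) hop
    have hz' : 0 < z.im := hz
    refine DifferentiableAt.mul (Complex.differentiableAt_Gamma _ fun k h => ?_) (DifferentiableAt.sub (differentiableAt_riemannZeta ?_) ?_)
    · rw [h] at hz'; simp at hz'
    · rintro rfl; simp at hz'
    · refine DifferentiableAt.fun_sum fun n hn => ?_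
      refine DifferentiableAt.const_cpow (by fun_prop) (Or.inl ?_)
      have := (Finset.mem_Icc.1 hn).1
      exact_mod_cast (by omega : n ≠ 0)
  have hb : AnalyticOnNhd ℂ (fun s => tailI m s + circI m s / (Complex.exp (2 * π * I * s) - 1)) {s : ℂ | 0 < s.im} := by
    refine DifferentiableOn.analyticOnNhd (fun z hz => DifferentiableAt.differentiableWithinAt ?_) hop
    exact (tailI_diff m z).add ((circI_diff m z).div (by fun_prop) (exp_two_pi_ne hz))
  have hpre : IsPreconnected {s : ℂ | 0 < s.im} := (convex_halfSpace_im_gt 0).isPreconnected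
  have hz0 : (2 + I : ℂ) ∈ {s : ℂ | 0 < s.im} := by simp
  refine ha.eqOn_of_preconnected_of_eventuallyEq hb hpre hz0 ?_ ht
  have hop2 : IsOpen {s : ℂ | 1 < s.re} := isOpen_lt continuous_const Complex.continuous_re
  filter_upwards [hop.mem_nhds hz0, hop2.mem_nhds (by simp : (2 + I : ℂ) ∈ {s : ℂ | 1 < s.re})] with z h1 h2
  exact hankel_gt m h2 h1



def seg (f : ℂ → ℂ) (a b : ℂ) : ℂ := ∫ τ in (0:ℝ)..1, f (a + τ * (b - a)) * (b - a)

lemma seg_prim {f F : ℂ → ℂ} {a b : ℂ}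
    (hF : ∀ τ : ℝ, 0 ≤ τ → τ ≤ 1 → HasDerivAt F (f (a + τ * (b - a))) (a + τ * (b - a)))
    (hf : ∀ τ : ℝ, 0 ≤ τ → τ ≤ 1 → ContinuousAt f (a + τ * (b - a))) : seg f a b = F b - F a := by
  unfold seg
  have h := intervalIntegral.integral_eq_sub_of_hasDerivAt (a := 0) (b := 1) (f := fun τ : ℝ => F (a + τ * (b - a)))
    (f' := fun τ : ℝ => f (a + τ * (b - a)) * (b - a)) ?_ ?_
  · rw [h]; simp
  · intro τ hτ
    rw [Set.uIcc_of_le zero_le_one] at hτ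
    have h1 : HasDerivAt (fun τ : ℝ => a + (τ:ℂ) * (b - a)) (b - a) τ := by
      have h2 : HasDerivAt (fun τ : ℝ => (τ:ℂ)) 1 τ := by exact Complex.ofRealCLM.hasDerivAt
      simpa using (h2.mul_const (b - a)).const_add a
    exact HasDerivAt.comp τ (hF τ hτ.1 hτ.2) h1
  · apply ContinuousOn.intervalIntegrable
    intro τ hτ
    rw [Set.uIcc_of_le zero_le_one] at hτ
    refine ContinuousAt.continuousWithinAt (ContinuousAt.mul ?_ continuousAt_const)
    exact ContinuousAt.comp (f := fun τ : ℝ => a + (τ:ℂ) * (b - a)) (hf τ hτ.1 hτ.2) (by fun_prop)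

lemma seg_mem {S : Set ℂ} (hS : Convex ℝ S) {a b : ℂ} (ha : a ∈ S) (hb : b ∈ S) {τ : ℝ} (h0 : 0 ≤ τ) (h1 : τ ≤ 1) :
    a + τ * (b - a) ∈ S := by
  have := hS.add_smul_sub_mem ha hb ⟨h0, h1⟩
  simpa [Complex.real_smul] using this

lemma exists_prim {f : ℂ → ℂ} {S : Set ℂ} (ho : IsOpen S) (hS : Convex ℝ S) (hf : DifferentiableOn ℂ f S) :
    ∃ F : ℂ → ℂ, (∀ w ∈ S, HasDerivAt F (f w) w) ∧ ∀ a ∈ S, ∀ b ∈ S, seg f a b = F b - F a := by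
  obtain ⟨F, hF⟩ := Convex.exists_forall_hasDerivWithinAt hS hf
  have hF' : ∀ w ∈ S, HasDerivAt F (f w) w := fun w hw => (hF w hw).hasDerivAt (ho.mem_nhds hw)
  refine ⟨F, hF', fun a ha b hb => seg_prim (fun τ h0 h1 => hF' _ (seg_mem hS ha hb h0 h1)) fun τ h0 h1 => ?_⟩
  exact (hf.differentiableAt (ho.mem_nhds (seg_mem hS ha hb h0 h1))).continuousAt

lemma pole_removal (Z : Finset ℂ) (c : ℂ → ℂ) : ∀ (S : Set ℂ) (f : ℂ → ℂ), IsOpen S → (∀ p ∈ Z, p ∈ S) →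
    DifferentiableOn ℂ f (S \ Z) →
    (∀ p ∈ Z, Filter.Tendsto (fun w => (w - p) * f w) (nhdsWithin p {p}ᶜ) (nhds (c p))) →
    ∃ g : ℂ → ℂ, DifferentiableOn ℂ g S ∧ ∀ w ∈ S, w ∉ Z → f w = g w + ∑ p ∈ Z, c p / (w - p) := by
  classical
  induction Z using Finset.induction_on with
  | empty => intro S f ho hZ hd hl; exact ⟨f, by simpa using hd, by simp⟩
  | insert p Z hp ih =>
    intro S f ho hZ hd hl
    obtain ⟨g, hg, hgf⟩ := ih (S \ {p}) f (ho.sdiff isClosed_singleton)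
      (fun q hq => ⟨hZ q (Finset.mem_insert_of_mem hq), fun h => hp (by rw [← Set.mem_singleton_iff.1 h]; exact hq)⟩)
      (hd.mono (by
        intro x hx; refine ⟨hx.1.1, fun h => ?_⟩
        rcases Finset.mem_insert.1 (Finset.mem_coe.1 h) with h | h
        · exact hx.1.2 h
        · exact hx.2 h))
      (fun q hq => hl q (Finset.mem_insert_of_mem hq))
    have hpS : p ∈ S := hZ p (Finset.mem_insert_self _ _)
    set g2 : ℂ → ℂ := fun w => g w - c p / (w - p) with hg2
    have hd2 : DifferentiableOn ℂ g2 (S \ {p}) := by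
      refine hg.sub ?_
      intro w hw
      refine (DifferentiableAt.div (by fun_prop) (by fun_prop) (sub_ne_zero.2 ?_)).differentiableWithinAt
      exact hw.2
    have hlim : Filter.Tendsto (fun w => (w - p) * g2 w) (nhdsWithin p {p}ᶜ) (nhds 0) := by
      have h1 := hl p (Finset.mem_insert_self _ _)
      have h2 : Filter.Tendsto (fun w => (w - p) * ∑ q ∈ Z, c q / (w - q)) (nhdsWithin p {p}ᶜ) (nhds 0) := by
        have : ContinuousAt (fun w => (w - p) * ∑ q ∈ Z, c q / (w - q)) p := by
          refine ContinuousAt.mul (by fun_prop) ?_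
          refine tendsto_finsetSum _ fun q hq => ?_
          refine ContinuousAt.div (by fun_prop) (by fun_prop) (sub_ne_zero.2 ?_)
          rintro rfl; exact hp hq
        have h3 := this.tendsto
        simp only [sub_self, zero_mul] at h3
        exact h3.mono_left nhdsWithin_le_nhds
      have h3 := (h1.sub h2).sub_const (c p)
      simp only [sub_zero, sub_self] at h3
      refine h3.congr' ?_
      have hZc : ((Z : Set ℂ))ᶜ ∈ nhds p := (Finset.isClosed Z).isOpen_compl.mem_nhds (by simpa using hp)
      filter_upwards [self_mem_nhdsWithin, mem_nhdsWithin_of_mem_nhds (ho.mem_nhds hpS), mem_nhdsWithin_of_mem_nhds hZc] with w hw1 hw2 hw3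
      have hne : w - p ≠ 0 := sub_ne_zero.2 hw1
      rw [hgf w ⟨hw2, hw1⟩ (by simpa using hw3), hg2]
      field_simp
      ring
    have hlo : (fun z => g2 z - g2 p) =o[nhdsWithin p {p}ᶜ] fun z => (z - p)⁻¹ := by
      rw [Asymptotics.isLittleO_iff_tendsto']
      · have h4 : Filter.Tendsto (fun w => (w - p) * g2 p) (nhdsWithin p {p}ᶜ) (nhds 0) := by
          have : ContinuousAt (fun w => (w - p) * g2 p) p := by fun_prop
          have h3 := this.tendsto
          simp only [sub_self, zero_mul] at h3
          exact h3.mono_left nhdsWithin_le_nhds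
        have h5 := hlim.sub h4
        rw [sub_zero] at h5
        refine h5.congr fun w => ?_
        rw [div_inv_eq_mul]; ring
      · filter_upwards [self_mem_nhdsWithin] with w hw h
        exact absurd (inv_eq_zero.1 h) (sub_ne_zero.2 hw)
    refine ⟨_, Complex.differentiableOn_update_limUnder_of_isLittleO (ho.mem_nhds hpS) hd2 hlo, fun w hw hwZ => ?_⟩
    rw [Finset.mem_insert, not_or] at hwZ
    rw [Function.update_of_ne hwZ.1, Finset.sum_insert hp, hgf w ⟨hw, hwZ.1⟩ hwZ.2]
    simp only [hg2]; ring

lemma seg_slit {p a b : ℂ} (h : 0 < ((b - p) / (a - p)).im) {τ : ℝ} (h0 : 0 ≤ τ) (h1 : τ ≤ 1) :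
    a + τ * (b - a) - p ≠ 0 ∧ (a + τ * (b - a) - p) / (a - p) ∈ Complex.slitPlane := by
  have ha : a - p ≠ 0 := by rintro h'; rw [h'] at h; simp at h
  have e : (a + τ * (b - a) - p) / (a - p) = (1 - τ : ℝ) + τ * ((b - p) / (a - p)) := by
    push_cast; field_simp; ring
  have hs : (a + τ * (b - a) - p) / (a - p) ∈ Complex.slitPlane := by
    rw [e]
    rcases h0.eq_or_lt with h' | h'
    · rw [← h']; simp
    · refine Or.inr (ne_of_gt ?_)
      rw [Complex.add_im, Complex.ofReal_im, Complex.im_ofReal_mul]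
      have := mul_pos h' h
      linarith
  refine ⟨fun h2 => ?_, hs⟩
  rw [h2, zero_div] at hs
  exact Complex.zero_notMem_slitPlane hs

lemma seg_log {p a b : ℂ} (h : 0 < ((b - p) / (a - p)).im) :
    seg (fun w => (w - p)⁻¹) a b = Complex.log ((b - p) / (a - p)) := by
  have ha : a - p ≠ 0 := by rintro h'; rw [h'] at h; simp at h
  rw [seg_prim (F := fun w => Complex.log ((w - p) / (a - p)))]
  · simp [div_self ha]
  · intro τ h0 h1
    obtain ⟨hne, hs⟩ := seg_slit h h0 h1
    have h2 : HasDerivAt (fun w => (w - p) / (a - p)) (1 / (a - p)) (a + τ * (b - a)) :=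
      ((hasDerivAt_id _).sub_const p).div_const _
    have h3 := h2.clog hs
    convert h3 using 1
    field_simp
  · intro τ h0 h1
    obtain ⟨hne, hs⟩ := seg_slit h h0 h1
    exact ContinuousAt.inv₀ (by fun_prop) hne

lemma four_logs {z1 z2 z3 z4 : ℂ} (h1 : 0 < z1.im) (h2 : 0 < z2.im) (h3 : 0 < z3.im) (h4 : 0 < z4.im)
    (hp : z1 * z2 * z3 * z4 = 1) :
    Complex.log z1 + Complex.log z2 + Complex.log z3 + Complex.log z4 = 2 * π * I := by
  have key : ∀ z : ℂ, 0 < z.im → z ≠ 0 ∧ 0 < (Complex.log z).im ∧ (Complex.log z).im < π := by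
    intro z hz
    have hz0 : z ≠ 0 := by rintro rfl; simp at hz
    refine ⟨hz0, ?_, ?_⟩
    · rw [Complex.log_im, Complex.arg_of_im_pos hz]
      apply Real.arccos_pos.2
      rw [div_lt_one (norm_pos_iff.2 hz0)]
      exact lt_of_le_of_ne (Complex.re_le_norm z) (fun h => by
        have := Complex.re_eq_norm.1 h
        rw [Complex.nonneg_iff] at this
        linarith [this.2])
    · rw [Complex.log_im]
      refine lt_of_le_of_ne (Complex.arg_le_pi z) fun h => ?_
      have := (Complex.arg_eq_pi_iff.1 h).2
      linarith
  obtain ⟨n1, a1, b1⟩ := key z1 h1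
  obtain ⟨n2, a2, b2⟩ := key z2 h2
  obtain ⟨n3, a3, b3⟩ := key z3 h3
  obtain ⟨n4, a4, b4⟩ := key z4 h4
  have he : Complex.exp (Complex.log z1 + Complex.log z2 + Complex.log z3 + Complex.log z4) = 1 := by
    rw [Complex.exp_add, Complex.exp_add, Complex.exp_add, Complex.exp_log n1, Complex.exp_log n2, Complex.exp_log n3, Complex.exp_log n4, hp]
  obtain ⟨n, hn⟩ := Complex.exp_eq_one_iff.1 he
  have him := congrArg Complex.im hn
  simp only [Complex.add_im] at him
  have e : ((n:ℂ) * (2 * π * I)).im = n * (2 * π) := by simp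
  rw [e] at him
  have hpi := Real.pi_pos
  have hn1 : (0:ℝ) < n := by
    by_contra hc; push Not at hc; nlinarith
  have hn2 : (n:ℝ) < 2 := by
    by_contra hc; push Not at hc; nlinarith
  have : n = 1 := by
    have q1 : 0 < n := by exact_mod_cast hn1
    have q2 : n < 2 := by exact_mod_cast hn2
    omega
  rw [hn, this]; simp

lemma seg_decomp {f g : ℂ → ℂ} {S : Set ℂ} (ho : IsOpen S) (hS : Convex ℝ S) (Z : Finset ℂ) (c : ℂ → ℂ)
    (hg : DifferentiableOn ℂ g S) (hfg : ∀ w ∈ S, w ∉ Z → f w = g w + ∑ p ∈ Z, c p / (w - p))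
    {a b : ℂ} (ha : a ∈ S) (hb : b ∈ S) (hc : ∀ p ∈ Z, 0 < ((b - p) / (a - p)).im) :
    seg f a b = seg g a b + ∑ p ∈ Z, c p * Complex.log ((b - p) / (a - p)) := by
  have e1 : seg f a b = ∫ τ in (0:ℝ)..1, (g (a + τ * (b - a)) * (b - a) +
      ∑ p ∈ Z, c p * ((a + τ * (b - a) - p)⁻¹ * (b - a))) := by
    unfold seg
    refine intervalIntegral.integral_congr fun τ hτ => ?_
    rw [Set.uIcc_of_le zero_le_one] at hτ
    rw [hfg _ (seg_mem hS ha hb hτ.1 hτ.2), add_mul, Finset.sum_mul]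
    · congr 1
      refine Finset.sum_congr rfl fun p hp => ?_
      rw [div_eq_mul_inv]; ring
    · intro hz
      have := (seg_slit (hc _ hz) hτ.1 hτ.2).1
      exact this (sub_self _)
  have i2 : ∀ p ∈ Z, IntervalIntegrable (fun τ : ℝ => c p * ((a + τ * (b - a) - p)⁻¹ * (b - a))) volume 0 1 := by
    intro p hp
    apply ContinuousOn.intervalIntegrable
    intro τ hτ
    rw [Set.uIcc_of_le zero_le_one] at hτ
    have := (seg_slit (hc _ hp) hτ.1 hτ.2).1
    refine ContinuousAt.continuousWithinAt ?_
    refine ContinuousAt.mul continuousAt_const (ContinuousAt.mul (ContinuousAt.inv₀ (by fun_prop) this) continuousAt_const)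
  have i1 : IntervalIntegrable (fun τ : ℝ => g (a + τ * (b - a)) * (b - a)) volume 0 1 := by
    apply ContinuousOn.intervalIntegrable
    intro τ hτ
    rw [Set.uIcc_of_le zero_le_one] at hτ
    refine ContinuousAt.continuousWithinAt (ContinuousAt.mul ?_ continuousAt_const)
    exact ContinuousAt.comp (f := fun τ : ℝ => a + (τ:ℂ) * (b - a))
      (hg.differentiableAt (ho.mem_nhds (seg_mem hS ha hb hτ.1 hτ.2))).continuousAt (by fun_prop)
  rw [e1, intervalIntegral.integral_add i1 (by
    have := IntervalIntegrable.sum Z i2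
    rw [Finset.sum_fn] at this
    exact this), intervalIntegral.integral_finsetSum i2]
  congr 1
  refine Finset.sum_congr rfl fun p hp => ?_
  rw [intervalIntegral.integral_const_mul, ← seg_log (hc p hp)]
  rfl

lemma quad_residue {f : ℂ → ℂ} {S : Set ℂ} (ho : IsOpen S) (hS : Convex ℝ S) (Z : Finset ℂ) (r : ℂ → ℂ)
    (hZ : ∀ p ∈ Z, p ∈ S) (hd : DifferentiableOn ℂ f (S \ Z))
    (hl : ∀ p ∈ Z, Filter.Tendsto (fun w => (w - p) * f w) (nhdsWithin p {p}ᶜ) (nhds (r p)))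
    {a b c d : ℂ} (ha : a ∈ S) (hb : b ∈ S) (hc : c ∈ S) (hdS : d ∈ S)
    (h1 : ∀ p ∈ Z, 0 < ((b - p) / (a - p)).im) (h2 : ∀ p ∈ Z, 0 < ((c - p) / (b - p)).im)
    (h3 : ∀ p ∈ Z, 0 < ((d - p) / (c - p)).im) (h4 : ∀ p ∈ Z, 0 < ((a - p) / (d - p)).im) :
    seg f a b + seg f b c + seg f c d + seg f d a = 2 * π * I * ∑ p ∈ Z, r p := by
  obtain ⟨g, hg, hfg⟩ := pole_removal Z r S f ho hZ hd hl
  obtain ⟨F, hF, hFs⟩ := exists_prim ho hS hg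
  rw [seg_decomp ho hS Z r hg hfg ha hb h1, seg_decomp ho hS Z r hg hfg hb hc h2,
    seg_decomp ho hS Z r hg hfg hc hdS h3, seg_decomp ho hS Z r hg hfg hdS ha h4,
    hFs a ha b hb, hFs b hb c hc, hFs c hc d hdS, hFs d hdS a ha]
  have e : ∑ p ∈ Z, r p * Complex.log ((b - p) / (a - p)) + ∑ p ∈ Z, r p * Complex.log ((c - p) / (b - p)) +
    ∑ p ∈ Z, r p * Complex.log ((d - p) / (c - p)) + ∑ p ∈ Z, r p * Complex.log ((a - p) / (d - p)) = 2 * π * I * ∑ p ∈ Z, r p := by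
    rw [← Finset.sum_add_distrib, ← Finset.sum_add_distrib, ← Finset.sum_add_distrib, Finset.mul_sum]
    refine Finset.sum_congr rfl fun p hp => ?_
    have n1 : a - p ≠ 0 := by intro h; have := h1 p hp; rw [h] at this; simp at this
    have n2 : b - p ≠ 0 := by intro h; have := h2 p hp; rw [h] at this; simp at this
    have n3 : c - p ≠ 0 := by intro h; have := h3 p hp; rw [h] at this; simp at this
    have n4 : d - p ≠ 0 := by intro h; have := h4 p hp; rw [h] at this; simp at this
    have := four_logs (h1 p hp) (h2 p hp) (h3 p hp) (h4 p hp) (by field_simp)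
    rw [← this]; ring
  rw [← e]; ring

lemma im_div_pos {z w : ℂ} (h : 0 < w.re * z.im - w.im * z.re) : 0 < (z / w).im := by
  have hw : w ≠ 0 := by rintro rfl; simp at h
  have hn : 0 < Complex.normSq w := Complex.normSq_pos.2 hw
  rw [Complex.div_im, ← sub_div]
  apply div_pos _ hn
  linarith



def ff (m : ℕ) (s w : ℂ) : ℂ := w ^ (s - 1) * KK m w

lemma ff_diff (m : ℕ) (s : ℂ) {w : ℂ} (hw : w ∈ Complex.slitPlane) (h : Complex.exp w ≠ 1) :
    DifferentiableAt ℂ (ff m s) w := by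
  unfold ff
  refine DifferentiableAt.mul ?_ (KK_diff m h)
  exact DifferentiableAt.cpow (by fun_prop) (by fun_prop) hw

lemma norm_ff (m : ℕ) (s : ℂ) {w : ℂ} (hw : w ≠ 0) :
    ‖ff m s w‖ = ‖w‖ ^ (s.re - 1) * Real.exp (-(Complex.arg w * s.im)) * ‖KK m w‖ := by
  unfold ff
  rw [norm_mul, Complex.norm_cpow_of_ne_zero hw, Real.exp_neg]
  simp [div_eq_mul_inv]

lemma norm_KK_re (m : ℕ) {w : ℂ} (hw : 1 ≤ w.re) : ‖KK m w‖ ≤ 2 * Real.exp (-1 * w.re) := by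
  refine le_trans ?_ (norm_KK_real_le' m hw)
  rw [norm_KK_real m (by linarith)]
  unfold KK
  rw [norm_div, Complex.norm_exp]
  have h1 : 1 < Real.exp w.re := Real.one_lt_exp_iff.2 (by linarith)
  have h2 : Real.exp w.re - 1 ≤ ‖Complex.exp w - 1‖ := by
    have := norm_sub_norm_le (Complex.exp w) 1
    rwa [Complex.norm_exp, norm_one] at this
  have h3 : (-(m:ℂ) * w).re = -(m:ℝ) * w.re := by simp
  rw [h3]
  exact div_le_div_of_nonneg_left (Real.exp_pos _).le (by linarith) h2

def strip (M : ℕ) : Set ℂ := {w : ℂ | 0 < w.im ∧ w.im < 2 * π * (M + 1)}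
def poles (M : ℕ) : Finset ℂ := (Finset.Icc 1 M).image fun v : ℕ => 2 * π * I * v

lemma strip_open (M : ℕ) : IsOpen (strip M) :=
  (isOpen_lt continuous_const Complex.continuous_im).inter (isOpen_lt Complex.continuous_im continuous_const)

lemma strip_convex (M : ℕ) : Convex ℝ (strip M) :=
  (convex_halfSpace_im_gt 0).inter (convex_halfSpace_im_lt _)

lemma poles_sub (M : ℕ) : ∀ p ∈ poles M, p ∈ strip M ∧ Complex.exp p = 1 ∧ p ∈ Complex.slitPlane := by
  intro p hp
  obtain ⟨v, hv, rfl⟩ := Finset.mem_image.1 hp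
  rw [Finset.mem_Icc] at hv
  have h1 : (1:ℝ) ≤ v := by exact_mod_cast hv.1
  have h2 : (v:ℝ) ≤ M := by exact_mod_cast hv.2
  have e : (2 * π * I * v : ℂ).im = 2 * π * v := by simp
  have hpi := Real.pi_pos
  refine ⟨⟨?_, ?_⟩, ?_, Or.inr ?_⟩
  · rw [e]; positivity
  · rw [e]; gcongr; linarith
  · rw [Complex.exp_eq_one_iff]; exact ⟨v, by push_cast; ring⟩
  · rw [e]; positivity

lemma strip_exp {M : ℕ} {w : ℂ} (hw : w ∈ strip M) (hp : w ∉ poles M) : Complex.exp w ≠ 1 := by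
  intro h
  obtain ⟨n, hn⟩ := Complex.exp_eq_one_iff.1 h
  have e : w.im = 2 * π * n := by rw [hn]; simp; ring
  have h1 := hw.1; have h2 := hw.2
  rw [e] at h1 h2
  have hpi := Real.pi_pos
  have a1 : (0:ℝ) < n := by
    by_contra hc; push Not at hc; nlinarith
  have a2 : (n:ℝ) < M + 1 := lt_of_mul_lt_mul_left h2 (by positivity)
  have b1 : 0 < n := by exact_mod_cast a1
  have b2 : n < M + 1 := by exact_mod_cast a2
  apply hp
  refine Finset.mem_image.2 ⟨n.toNat, Finset.mem_Icc.2 ⟨by omega, by omega⟩, ?_⟩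
  rw [hn]
  have : ((n.toNat : ℕ) : ℂ) = (n : ℂ) := by
    have : ((n.toNat : ℤ)) = n := Int.toNat_of_nonneg b1.le
    exact_mod_cast congrArg (fun k : ℤ => (k : ℂ)) this
  rw [this]; ring

lemma ff_residue (m : ℕ) (s : ℂ) {p : ℂ} (hp : Complex.exp p = 1) (hs : p ∈ Complex.slitPlane) :
    Filter.Tendsto (fun w => (w - p) * ff m s w) (nhdsWithin p {p}ᶜ) (nhds (p ^ (s - 1))) := by
  have h1 := (Complex.hasDerivAt_exp p).tendsto_slope
  rw [hp] at h1
  have h2 := h1.inv₀ one_ne_zero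
  have h3 : ContinuousAt (fun w : ℂ => w ^ (s - 1) * Complex.exp (-(m:ℂ) * w)) p := by
    refine ContinuousAt.mul ?_ (by fun_prop)
    exact ContinuousAt.cpow continuousAt_id continuousAt_const hs
  have h4 := (h3.tendsto.mono_left (nhdsWithin_le_nhds (s := {p}ᶜ))).mul h2
  have e : p ^ (s - 1) * Complex.exp (-(m:ℂ) * p) * 1⁻¹ = p ^ (s - 1) := by
    have : Complex.exp (-(m:ℂ) * p) = 1 := by
      rw [neg_mul, Complex.exp_neg, Complex.exp_nat_mul, hp]; simp
    rw [this]; simp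
  rw [e] at h4
  refine h4.congr fun w => ?_
  simp only [slope_def_field, hp, inv_div, ff, KK]
  ring

def rr : ℝ := √2 / 2
lemma rr_pos : 0 < rr := by unfold rr; positivity
lemma rr_lt : rr < 1 := by
  unfold rr
  have : √2 < 2 := by rw [Real.sqrt_lt' (by norm_num)]; norm_num
  linarith

lemma quad_ff (m M : ℕ) (hM : 1 ≤ M) (s : ℂ) (Y : ℝ) (hY : Y = 2 * π * (M + 1/2)) :
    seg (ff m s) (-rr + rr * I) (rr + rr * I) + seg (ff m s) (rr + rr * I) (1 + (Y + 1) * I)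
     + seg (ff m s) (1 + (Y + 1) * I) (-(Y/2) + (Y/2) * I) + seg (ff m s) (-(Y/2) + (Y/2) * I) (-rr + rr * I)
      = 2 * π * I * ∑ v ∈ Finset.Icc 1 M, (2 * π * I * v : ℂ) ^ (s - 1) := by
  have hpi := Real.pi_gt_three
  have hM1 : (1:ℝ) ≤ M := by exact_mod_cast hM
  have hr := rr_pos
  have hr1 := rr_lt
  have hYM : 9 ≤ Y := by rw [hY]; nlinarith
  have hpp : ∀ p ∈ poles M, ∃ y : ℝ, p = y * I ∧ 6 ≤ y ∧ y < Y := by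
    intro p hp
    obtain ⟨v, hv, rfl⟩ := Finset.mem_image.1 hp
    rw [Finset.mem_Icc] at hv
    have h1 : (1:ℝ) ≤ v := by exact_mod_cast hv.1
    have h2 : (v:ℝ) ≤ M := by exact_mod_cast hv.2
    refine ⟨2 * π * v, by push_cast; ring, by nlinarith, ?_⟩
    rw [hY]; gcongr; linarith
  have hS : rr < 2 * π * (M + 1) := by nlinarith
  have hS1 : Y + 1 < 2 * π * (M + 1) := by rw [hY]; nlinarith
  have h := quad_residue (f := ff m s) (strip_open M) (strip_convex M) (poles M) (fun p => p ^ (s-1))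
    (fun p hp => (poles_sub M p hp).1)
    (fun w hw => (ff_diff m s (Or.inr hw.1.1.ne') (strip_exp hw.1 hw.2)).differentiableWithinAt)
    (fun p hp => ff_residue m s (poles_sub M p hp).2.1 (poles_sub M p hp).2.2)
    (a := -rr + rr * I) (b := rr + rr * I) (c := 1 + (Y + 1) * I) (d := -(Y/2) + (Y/2) * I)
    (by constructor <;> simp <;> linarith) (by constructor <;> simp <;> linarith)
    (by constructor <;> simp <;> linarith) (by constructor <;> simp <;> linarith) ?_ ?_ ?_ ?_
  · rw [h, poles, Finset.sum_image]
    intro v hv w hw h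
    simpa [Real.pi_ne_zero] using h
  all_goals
    intro p hp
    obtain ⟨y, rfl, hy1, hy2⟩ := hpp p hp
    apply im_div_pos
    simp
    nlinarith [mul_pos hr (by linarith : 0 < y - rr), mul_pos (by linarith : 0 < Y) (by linarith : 0 < Y - y), mul_pos (by linarith : 0 < y) (by linarith : 0 < Y/2 - rr), mul_pos hr (by linarith : 0 < Y - y)]



def D0 : Set ℂ := Metric.ball 0 (2*π) ∩ {w : ℂ | 0 < w.re * Real.cos (3*π/8) + w.im * Real.sin (3*π/8)}

lemma D0_open : IsOpen D0 := Metric.isOpen_ball.inter (isOpen_lt continuous_const (by fun_prop))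

lemma D0_convex : Convex ℝ D0 := by
  refine (convex_ball _ _).inter ?_
  have hl : IsLinearMap ℝ (fun w : ℂ => w.re * Real.cos (3*π/8) + w.im * Real.sin (3*π/8)) := by
    constructor
    · intro x y; simp; ring
    · intro c x; simp; ring
  exact convex_halfSpace_gt hl 0

lemma D0_mem {θ : ℝ} (h0 : 0 ≤ θ) (h1 : θ ≤ 3*π/4) : Complex.exp (θ * I) ∈ D0 := by
  have hpi := Real.pi_gt_three
  constructor
  · simp [Complex.norm_exp_ofReal_mul_I]; linarith
  · simp only [Set.mem_ofPred_eq, Complex.exp_ofReal_mul_I_re, Complex.exp_ofReal_mul_I_im]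
    rw [← Real.cos_sub]
    apply Real.cos_pos_of_mem_Ioo
    constructor <;> linarith

lemma D0_slit {w : ℂ} (h : w ∈ D0) : w ∈ Complex.slitPlane ∧ Complex.exp w ≠ 1 := by
  have hpi := Real.pi_gt_three
  have h2 := h.2
  simp only [Set.mem_ofPred_eq] at h2
  have hc : 0 < Real.cos (3*π/8) := Real.cos_pos_of_mem_Ioo ⟨by linarith, by linarith⟩
  have hw0 : w ≠ 0 := by rintro rfl; simp at h2
  refine ⟨?_, exp_ne_one_of_im hw0 ?_⟩
  · by_contra hn
    rw [Complex.mem_slitPlane_iff, not_or] at hn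
    push Not at hn
    rw [hn.2] at h2
    nlinarith [hn.1]
  · have := h.1
    rw [Metric.mem_ball, dist_zero_right] at this
    exact (Complex.abs_im_le_norm w).trans_lt this

def arcI (m : ℕ) (s : ℂ) : ℂ := I * ∫ θ in (0:ℝ)..(3*π/4), Complex.exp (s * (θ * I)) * KK m (Complex.exp (θ * I))

lemma exp_3pi4 : Complex.exp ((3*π/4 : ℝ) * I) = -rr + rr * I := by
  rw [Complex.exp_mul_I, ← Complex.ofReal_cos, ← Complex.ofReal_sin,
    show (3*π/4:ℝ) = π - π/4 by ring, Real.cos_pi_sub, Real.sin_pi_sub, Real.cos_pi_div_four, Real.sin_pi_div_four]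
  simp [rr]

lemma exp_pi4 : Complex.exp ((π/4 : ℝ) * I) = rr + rr * I := by
  rw [Complex.exp_mul_I, ← Complex.ofReal_cos, ← Complex.ofReal_sin, Real.cos_pi_div_four, Real.sin_pi_div_four]
  simp [rr]

lemma arc_prim (m : ℕ) (s : ℂ) {F : ℂ → ℂ} (hF : ∀ w ∈ D0, HasDerivAt F (ff m s w) w) :
    arcI m s = F (-rr + rr * I) - F 1 := by
  have hpi := Real.pi_gt_three
  unfold arcI
  rw [← intervalIntegral.integral_const_mul]
  have h := intervalIntegral.integral_eq_sub_of_hasDerivAt (a := 0) (b := 3*π/4) (f := fun θ : ℝ => F (Complex.exp (θ * I)))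
    (f' := fun θ : ℝ => I * (Complex.exp (s * (θ * I)) * KK m (Complex.exp (θ * I)))) ?_ ?_
  · rw [h, exp_3pi4]; simp
  · intro θ hθ
    rw [Set.uIcc_of_le (by positivity)] at hθ
    have h1 : HasDerivAt (fun θ : ℝ => Complex.exp ((θ:ℂ) * I)) (Complex.exp (θ * I) * I) θ := by
      have h2 : HasDerivAt (fun τ : ℝ => (τ:ℂ)) 1 θ := by exact Complex.ofRealCLM.hasDerivAt
      have h3 := (h2.mul_const I).cexp
      simpa using h3
    have h2 := HasDerivAt.comp θ (hF _ (D0_mem hθ.1 hθ.2)) h1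
    have ev : I * (Complex.exp (s * (θ * I)) * KK m (Complex.exp (θ * I))) = ff m s (Complex.exp (θ * I)) * (Complex.exp (θ * I) * I) := by
      unfold ff
      rw [Complex.cpow_def_of_ne_zero (Complex.exp_ne_zero _), Complex.log_exp (by simp; linarith [hθ.1]) (by simp; linarith [hθ.2])]
      rw [show s * (θ * I) = θ * I * (s - 1) + θ * I by ring, Complex.exp_add]
      ring
    rw [ev]
    exact h2
  · have hk := KK_circ_cont m
    exact (Continuous.mul continuous_const (Continuous.mul (by fun_prop) hk)).intervalIntegrable _ _

def DR : Set ℂ := {w : ℂ | 0 < w.re}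
lemma DR_open : IsOpen DR := isOpen_lt continuous_const Complex.continuous_re
lemma DR_convex : Convex ℝ DR := convex_halfSpace_re_gt 0
lemma DR_diff (m : ℕ) (s : ℂ) : DifferentiableOn ℂ (ff m s) DR := fun w hw =>
  (ff_diff m s (Or.inl hw) (exp_ne_one_of_re (ne_of_gt hw))).differentiableWithinAt
lemma D0_diff (m : ℕ) (s : ℂ) : DifferentiableOn ℂ (ff m s) D0 := fun w hw =>
  (ff_diff m s (D0_slit hw).1 (D0_slit hw).2).differentiableWithinAt

lemma tail_lim (m : ℕ) (s : ℂ) {F : ℂ → ℂ} (hF : ∀ w ∈ DR, HasDerivAt F (ff m s w) w) :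
    Filter.Tendsto (fun X : ℝ => F X - F 1) Filter.atTop (nhds (tailI m s)) := by
  have h1 := intervalIntegral_tendsto_integral_Ioi 1 (tail_integrable m s) Filter.tendsto_id
  refine h1.congr' ?_
  filter_upwards [Filter.eventually_ge_atTop 1] with X hX
  have h := intervalIntegral.integral_eq_sub_of_hasDerivAt (a := 1) (b := X) (f := fun x : ℝ => F x)
    (f' := fun x : ℝ => (x:ℂ)^(s-1) * KK m x) ?_ ?_
  · simp only [id]; rw [h]; simp
  · intro x hx
    rw [Set.uIcc_of_le hX] at hx
    have hx0 : (x:ℂ) ∈ DR := by simp [DR]; linarith [hx.1]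
    exact (hF _ hx0).comp_ofReal
  · rw [intervalIntegrable_iff, Set.uIoc_of_le hX]
    exact (tail_integrable m s).mono_set Set.Ioc_subset_Ioi_self

lemma vert_bound (m : ℕ) (s : ℂ) (ht : 0 < s.im) {Y : ℝ} (hY : 0 < Y) (n : ℕ) (hn : |s.re - 1| ≤ n) {X : ℝ} (hX : 1 ≤ X) (hXY : Y ≤ X) :
    ‖seg (ff m s) X (X + (Y + X) * I)‖ ≤ (4 * 3 ^ n) * (X ^ (n+1) * Real.exp (-X)) := by
  unfold seg
  have h := intervalIntegral.norm_integral_le_of_norm_le_const (a := 0) (b := 1)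
    (f := fun τ : ℝ => ff m s (X + τ * (X + (Y + X) * I - X)) * (X + (Y + X) * I - X))
    (C := (4 * 3 ^ n) * (X ^ (n+1) * Real.exp (-X))) ?_
  · simpa using h
  · intro τ hτ
    rw [Set.uIoc_of_le zero_le_one] at hτ
    set w : ℂ := X + τ * (X + (Y + X) * I - X) with hw
    have hre : w.re = X := by simp [hw]
    have him : w.im = τ * (Y + X) := by simp [hw]
    have hw0 : w ≠ 0 := by intro h; rw [h] at hre; simp at hre; linarith
    have him0 : 0 ≤ w.im := by rw [him]; exact mul_nonneg hτ.1.le (by linarith)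
    rw [norm_mul, norm_ff m s hw0]
    have a1 : Real.exp (-(Complex.arg w * s.im)) ≤ 1 := by
      apply Real.exp_le_one_iff.2
      have := mul_nonneg (Complex.arg_nonneg_iff.2 him0) ht.le
      linarith
    have a2 : ‖KK m w‖ ≤ 2 * Real.exp (-X) := by
      have := norm_KK_re m (w := w) (by rw [hre]; exact hX)
      rw [hre, neg_one_mul] at this; exact this
    have a3 : 1 ≤ ‖w‖ := by
      have := Complex.re_le_norm w; rw [hre] at this; linarith
    have a4 : ‖w‖ ≤ 3 * X := by
      have := Complex.norm_le_abs_re_add_abs_im w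
      rw [abs_of_nonneg him0, hre, him, abs_of_pos (by linarith)] at this
      have : τ * (Y + X) ≤ 1 * (Y + X) := by gcongr; exact hτ.2
      linarith
    have a5 : ‖w‖ ^ (s.re - 1) ≤ (3 * X) ^ n := by
      calc ‖w‖ ^ (s.re - 1) ≤ ‖w‖ ^ (n:ℝ) := Real.rpow_le_rpow_of_exponent_le a3 ((le_abs_self _).trans hn)
        _ = ‖w‖ ^ n := Real.rpow_natCast _ _
        _ ≤ _ := by gcongr
    have a6 : ‖(X + (Y + X) * I - X : ℂ)‖ ≤ 2 * X := by
      have : (X + (Y + X) * I - X : ℂ) = ((Y + X : ℝ) : ℂ) * I := by push_cast; ring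
      rw [this, norm_mul, norm_I, Complex.norm_of_nonneg (by linarith)]
      linarith
    calc _ ≤ (3 * X) ^ n * 1 * (2 * Real.exp (-X)) * (2 * X) := by gcongr
      _ = _ := by ring

lemma move (m M : ℕ) (hM : 1 ≤ M) (s : ℂ) (ht : 0 < s.im) (Y : ℝ) (hY : Y = 2 * π * (M + 1/2)) :
    Filter.Tendsto (fun X : ℝ => seg (ff m s) (1 + (Y + 1) * I) (X + (Y + X) * I)) Filter.atTop
      (nhds (tailI m s - arcI m s - 2 * π * I * ∑ v ∈ Finset.Icc 1 M, (2 * π * I * v : ℂ) ^ (s - 1)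
        + seg (ff m s) (1 + (Y + 1) * I) (-(Y/2) + (Y/2) * I) + seg (ff m s) (-(Y/2) + (Y/2) * I) (-rr + rr * I))) := by
  have hpi := Real.pi_gt_three
  have hY0 : 0 < Y := by rw [hY]; positivity
  obtain ⟨F0, hF0, hs0⟩ := exists_prim D0_open D0_convex (D0_diff m s)
  obtain ⟨FR, hFR, hsR⟩ := exists_prim DR_open DR_convex (DR_diff m s)
  have q := quad_ff m M hM s Y hY
  have hA := arc_prim m s hF0
  have hP0 : (-rr + rr * I : ℂ) ∈ D0 := by rw [← exp_3pi4]; exact D0_mem (by positivity) le_rfl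
  have hb0 : (rr + rr * I : ℂ) ∈ D0 := by rw [← exp_pi4]; exact D0_mem (by positivity) (by linarith)
  have h10 : (1 : ℂ) ∈ D0 := by
    have := D0_mem (θ := 0) le_rfl (by positivity); simpa using this
  have hbR : (rr + rr * I : ℂ) ∈ DR := by simp [DR, rr_pos]
  have h1R : (1 : ℂ) ∈ DR := by simp [DR]
  have hwR : (1 + (Y + 1) * I : ℂ) ∈ DR := by simp [DR]
  have e1 := hs0 _ h10 _ hb0
  have e2 := hsR _ h1R _ hbR
  have e3 := hs0 _ hP0 _ hb0
  have e4 := hsR _ hbR _ hwR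
  have hlim := tail_lim m s hFR
  have hv : Filter.Tendsto (fun X : ℝ => seg (ff m s) X (X + (Y + X) * I)) Filter.atTop (nhds 0) := by
    obtain ⟨n, hn⟩ := exists_nat_ge |s.re - 1|
    refine squeeze_zero_norm' (a := fun X : ℝ => (4 * 3 ^ n) * (X ^ (n+1) * Real.exp (-X))) ?_ ?_
    · filter_upwards [Filter.eventually_ge_atTop 1, Filter.eventually_ge_atTop Y] with X h1 h2
      exact vert_bound m s ht hY0 n hn h1 h2
    · have := (Real.tendsto_pow_mul_exp_neg_atTop_nhds_zero (n+1)).const_mul (4 * 3 ^ n)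
      simpa using this
  have hsum := (hlim.add hv).add_const (FR 1 - FR (1 + (Y + 1) * I))
  have etarget : tailI m s + 0 + (FR 1 - FR (1 + (Y + 1) * I)) = tailI m s - arcI m s - 2 * π * I * ∑ v ∈ Finset.Icc 1 M, (2 * π * I * v : ℂ) ^ (s - 1)
        + seg (ff m s) (1 + (Y + 1) * I) (-(Y/2) + (Y/2) * I) + seg (ff m s) (-(Y/2) + (Y/2) * I) (-rr + rr * I) := by
    rw [← q, hA, e3, e4]
    linear_combination e2 - e1
  rw [← etarget]
  refine hsum.congr' ?_
  filter_upwards [Filter.eventually_ge_atTop 1] with X hX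
  have hXR : (X : ℂ) ∈ DR := by simp [DR]; linarith
  have hX2R : (X + (Y + X) * I : ℂ) ∈ DR := by simp [DR]; linarith
  rw [hsR _ hXR _ hX2R, hsR _ hwR _ hX2R]
  ring



lemma one_add_exp_lower (a : ℝ) : (1 + Real.exp a) / 2 ≤ ‖1 + Complex.exp (a * (1 + I))‖ := by
  have e : Complex.exp (a * (1 + I)) = (Real.exp a * Real.cos a : ℝ) + (Real.exp a * Real.sin a : ℝ) * I := by
    rw [show (a * (1 + I) : ℂ) = a + a * I by ring, Complex.exp_add, Complex.exp_mul_I]; push_cast; ring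
  have hE := Real.exp_pos a
  have hsq : ‖1 + Complex.exp (a * (1 + I))‖ ^ 2 = 1 + 2 * Real.exp a * Real.cos a + Real.exp a ^ 2 := by
    rw [e, ← Complex.normSq_eq_norm_sq, Complex.normSq_apply]
    simp only [add_re, one_re, ofReal_re, mul_re, I_re, mul_zero, ofReal_im, I_im, add_im, one_im, mul_im, mul_one, zero_add, add_zero, sub_zero, sub_self]
    nlinarith [Real.sin_sq_add_cos_sq a]
  apply le_of_sq_le_sq _ (norm_nonneg _)
  rw [hsq]
  rcases le_total |a| (π/2) with h | h
  · have hc : 0 ≤ Real.cos a := Real.cos_nonneg_of_mem_Icc (abs_le.1 h)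
    nlinarith [mul_nonneg hE.le hc, sq_nonneg (1 - Real.exp a)]
  · have hc := Real.neg_one_le_cos a
    have h3 : 3/2 ≤ |a| := by linarith [Real.pi_gt_three]
    have key : ∀ x : ℝ, 3/2 ≤ x → 3 ≤ Real.exp x := by
      intro x hx
      have := Real.quadratic_le_exp_of_nonneg (x := x) (by linarith)
      nlinarith
    have h4 : 3 ≤ Real.exp a ∨ 3 * Real.exp a ≤ 1 := by
      rcases le_total 0 a with ha | ha
      · rw [abs_of_nonneg ha] at h3; exact Or.inl (key a h3)
      · rw [abs_of_nonpos ha] at h3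
        right
        have h5 := key _ h3
        have h6 : Real.exp (-a) * Real.exp a = 1 := by rw [← Real.exp_add]; simp
        nlinarith
    have h5 : (1 - Real.exp a)^2 ≤ 1 + 2 * Real.exp a * Real.cos a + Real.exp a ^ 2 := by nlinarith
    refine le_trans ?_ h5
    rcases h4 with h4 | h4 <;> nlinarith

lemma KK_line (m : ℕ) {α a Y : ℝ} (hm : m ≤ α) (hm1 : α < m + 1) (hY : Complex.exp (Y * I) = -1) :
    ‖KK m (a + (Y + a) * I)‖ ≤ 2 * Real.exp (-(α * a)) := by
  unfold KK
  have e1 : Complex.exp (a + (Y + a) * I) - 1 = -(1 + Complex.exp (a * (1 + I))) := by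
    rw [show (a + (Y + a) * I : ℂ) = a * (1 + I) + Y * I by ring, Complex.exp_add, hY]; ring
  rw [norm_div, e1, norm_neg, Complex.norm_exp]
  have e2 : (-(m:ℂ) * (a + (Y + a) * I)).re = -(m * a) := by simp
  rw [e2]
  have h1 := one_add_exp_lower a
  have hE := Real.exp_pos a
  rw [div_le_iff₀ (by linarith)]
  have h2 : Real.exp (-(m*a)) ≤ Real.exp (-(α * a)) * (1 + Real.exp a) := by
    rw [mul_add, mul_one, ← Real.exp_add]
    rcases le_total 0 a with ha | ha
    · have : Real.exp (-(m*a)) ≤ Real.exp (-(α*a) + a) := Real.exp_le_exp.2 (by nlinarith)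
      have := Real.exp_pos (-(α*a))
      linarith
    · have : Real.exp (-(m*a)) ≤ Real.exp (-(α*a)) := Real.exp_le_exp.2 (by nlinarith)
      have := Real.exp_pos (-(α*a) + a)
      linarith
  have h3 := Real.exp_pos (-(α*a))
  nlinarith

lemma arctan_aux {r : ℝ} (h0 : 0 ≤ r) (h1 : r ≤ 1/2) : r + r^2/2 ≤ Real.arctan (r / (1 - r)) := by
  have hd : ∀ x ∈ Set.Icc (0:ℝ) (1/2), HasDerivAt (fun x => Real.arctan (x / (1 - x)) - x - x^2/2)
      (1 / (1 + (x/(1-x))^2) * ((1 * (1 - x) - x * (0 - 1)) / (1 - x)^2) - 1 - (2 * x)/2) x := by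
    intro x hx
    have hx1 : 1 - x ≠ 0 := by linarith [hx.2]
    have a1 : HasDerivAt (fun x : ℝ => x / (1 - x)) ((1 * (1 - x) - x * (0 - 1)) / (1 - x)^2) x :=
      (hasDerivAt_id x).div ((hasDerivAt_const x (1:ℝ)).sub (hasDerivAt_id x)) hx1
    have a2 := (a1.arctan.sub (hasDerivAt_id x)).sub ((hasDerivAt_pow 2 x).div_const 2)
    refine HasDerivAt.congr_deriv (f := fun x => Real.arctan (x / (1 - x)) - x - x^2/2) a2 ?_
    norm_num
  have hm : MonotoneOn (fun x => Real.arctan (x / (1 - x)) - x - x^2/2) (Set.Icc (0:ℝ) (1/2)) := by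
    apply monotoneOn_of_deriv_nonneg (convex_Icc _ _)
    · intro x hx; exact (hd x hx).continuousAt.continuousWithinAt
    · intro x hx; rw [interior_Icc] at hx
      exact (hd x ⟨hx.1.le, hx.2.le⟩).differentiableAt.differentiableWithinAt
    · intro x hx; rw [interior_Icc] at hx
      rw [(hd x ⟨hx.1.le, hx.2.le⟩).deriv]
      have hx1 : 0 < 1 - x := by linarith [hx.2]
      have e : 1 / (1 + (x/(1-x))^2) * ((1 * (1 - x) - x * (0 - 1)) / (1 - x)^2) = 1 / ((1-x)^2 + x^2) := by
        field_simp; ring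
      rw [e]
      have hp : 0 < (1-x)^2 + x^2 := by positivity
      have : 1 + x ≤ 1 / ((1-x)^2 + x^2) := by
        rw [le_div_iff₀ hp]
        have := hx.1; have := hx.2
        nlinarith [mul_pos hx.1 hx1, mul_pos (mul_pos hx.1 hx.1) hx1, mul_pos hx.1 (by linarith : 0 < 1/2 - x)]
      linarith
  have := hm (Set.left_mem_Icc.2 (by norm_num)) ⟨h0, h1⟩ h0
  simp at this
  linarith

lemma arctan_line {ρ : ℝ} (h : -1/2 ≤ ρ) : Real.arctan (ρ / (1 + ρ)) ≤ ρ - (ρ^2 / (1 + |ρ|)) / 2 := by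
  rcases le_total 0 ρ with h0 | h0
  · rw [abs_of_nonneg h0]
    refine (arctan_le_self' (by positivity)).trans ?_
    have : ρ / (1 + ρ) = ρ - ρ^2/(1+ρ) := by field_simp; ring
    have : 0 ≤ ρ^2/(1+ρ) := by positivity
    linarith
  · rw [abs_of_nonpos h0]
    have h1 := arctan_aux (r := -ρ) (by linarith) (by linarith)
    have e : (-ρ) / (1 - -ρ) = -(ρ / (1 + ρ)) := by rw [sub_neg_eq_add, neg_div]
    rw [e, Real.arctan_neg] at h1
    have : ρ^2 / (1 + -ρ) ≤ ρ^2 := div_le_self (by positivity) (by linarith)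
    nlinarith

lemma pow_exp_bound (N : ℕ) {X : ℝ} (hX : 0 ≤ X) : (1 + X)^N ≤ (2 * (N + 1))^N * Real.exp (X/2) := by
  rcases Nat.eq_zero_or_pos N with h | h
  · subst h; simp; positivity
  · have hN : (0:ℝ) < N := by exact_mod_cast h
    have h1 := Real.add_one_le_exp (X / (2 * N))
    have h2 : 1 + X ≤ (2 * (N + 1)) * Real.exp (X / (2 * N)) := by
      have : 1 + X ≤ (2 * (N + 1)) * (X / (2 * N) + 1) := by
        have e : (2 * ((N:ℝ) + 1)) * (X / (2 * N) + 1) = X + X / N + 2 * (N + 1) := by field_simp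
        rw [e]
        have : 0 ≤ X / N := by positivity
        linarith
      refine this.trans ?_
      gcongr
    calc (1 + X)^N ≤ ((2 * (N + 1)) * Real.exp (X / (2 * N)))^N := by gcongr
      _ = _ := by
        rw [mul_pow, ← Real.exp_nat_mul]; congr 2; field_simp

lemma decay_bound (n : ℕ) {t ρ : ℝ} (ht : 1 ≤ t) :
    (2 * (1 + |ρ|))^n * Real.exp (-(t * (ρ^2 / (1 + |ρ|)) / 2)) ≤ (2 * 4^n * (2 * ((n+2 : ℕ) + 1))^(n+2)) / (1 + t * ρ^2) := by
  have hr := abs_nonneg ρ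
  have hsq : ρ^2 = |ρ|^2 := (sq_abs ρ).symm
  rw [hsq]
  generalize |ρ| = r at *
  set X := t * (r^2 / (1 + r)) with hXdef
  have hX : 0 ≤ X := by positivity
  have h1 : 1 + r ≤ 2 * (1 + X) := by
    rcases le_total r 1 with h | h
    · linarith
    · have : r / 2 ≤ X := by
        have : r/2 ≤ r^2 / (1 + r) := by rw [div_le_div_iff₀ (by norm_num) (by linarith)]; nlinarith
        nlinarith [(by positivity : 0 ≤ r^2/(1+r))]
      linarith
  have h2 : t * r^2 = X * (1 + r) := by rw [hXdef]; field_simp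
  have h3 : 1 + t * r^2 ≤ 2 * (1 + X)^2 := by rw [h2]; nlinarith
  have h4 := pow_exp_bound (n+2) hX
  rw [le_div_iff₀ (by positivity)]
  have h5 : Real.exp (-(X/2)) * Real.exp (X/2) = 1 := by rw [← Real.exp_add]; simp
  calc _ ≤ (2 * (2 * (1 + X)))^n * Real.exp (-(X/2)) * (2 * (1 + X)^2) := by gcongr
    _ = 2 * 4^n * Real.exp (-(X/2)) * (1 + X)^(n+2) := by
        rw [show 2 * (2 * (1 + X)) = 4 * (1 + X) by ring, mul_pow]; ring
    _ ≤ 2 * 4^n * Real.exp (-(X/2)) * ((2 * ((n+2 : ℕ) + 1))^(n+2) * Real.exp (X/2)) := by gcongr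
    _ = 2 * 4^n * (2 * ((n+2 : ℕ) + 1))^(n+2) * (Real.exp (-(X/2)) * Real.exp (X/2)) := by ring
    _ = _ := by rw [h5, mul_one]

def Cn (n : ℕ) : ℝ := 2 * (2 * 4^n * (2 * ((n+2 : ℕ) + 1))^(n+2))
lemma Cn_pos (n : ℕ) : 0 < Cn n := by unfold Cn; positivity

lemma ff_line (n m : ℕ) {s : ℂ} {α Y ρ : ℝ} (hn : |s.re - 1| ≤ n) (ht1 : 1 ≤ s.im) (hY0 : 0 < Y) (htY : s.im = α * Y)
    (hm : m ≤ α) (hm1 : α < m + 1) (hY : Complex.exp (Y * I) = -1) (hρ : -1/2 ≤ ρ) :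
    ‖ff m s ((Y * ρ : ℝ) + (Y + (Y * ρ : ℝ)) * I)‖ ≤
      Cn n * Y ^ (s.re - 1) * Real.exp (-(π/2) * s.im) / (1 + s.im * ρ^2) := by
  set w : ℂ := (Y * ρ : ℝ) + (Y + (Y * ρ : ℝ)) * I with hw
  have hre : w.re = Y * ρ := by simp [hw]
  have him : w.im = Y * (1 + ρ) := by simp [hw]; ring
  have him0 : 0 < w.im := by rw [him]; apply mul_pos hY0; linarith
  have hw0 : w ≠ 0 := by rintro h; rw [h] at him0; simp at him0
  have hK := KK_line m (a := Y * ρ) hm hm1 hY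
  rw [← hw] at hK
  have harg : Complex.arg w = π/2 - Real.arctan (ρ / (1 + ρ)) := by
    rw [arg_of_upper him0, hre, him, mul_div_mul_left _ _ hY0.ne']
  have hat := arctan_line hρ
  have hnorm1 : ‖w‖ ≤ (2 * (1 + |ρ|)) * Y := by
    have h1 := Complex.norm_le_abs_re_add_abs_im w
    rw [abs_of_pos him0, hre, him, abs_mul, abs_of_pos hY0] at h1
    nlinarith [le_abs_self ρ, abs_nonneg ρ, mul_le_mul_of_nonneg_left (le_abs_self ρ) hY0.le]
  have hnorm2 : Y ≤ (2 * (1 + |ρ|)) * ‖w‖ := by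
    have h1 : Y/2 ≤ ‖w‖ := by
      have := (le_abs_self _).trans (Complex.abs_im_le_norm w)
      rw [him] at this
      nlinarith
    nlinarith [abs_nonneg ρ, norm_nonneg w]
  have hr := rpow_ratio_bound (r := s.re - 1) (K := 2 * (1 + |ρ|)) (by linarith [abs_nonneg ρ]) (norm_pos_iff.2 hw0) hY0 hnorm1 hnorm2
  have hr2 : (2 * (1 + |ρ|)) ^ |s.re - 1| ≤ (2 * (1 + |ρ|)) ^ n := by
    rw [← Real.rpow_natCast]
    exact Real.rpow_le_rpow_of_exponent_le (by linarith [abs_nonneg ρ]) hn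
  have hYp := Real.rpow_pos_of_pos hY0 (s.re - 1)
  rw [norm_ff m s hw0]
  have hexp : Real.exp (-(Complex.arg w * s.im)) * (2 * Real.exp (-(α * (Y * ρ)))) ≤
      2 * (Real.exp (-(π/2) * s.im) * Real.exp (-(s.im * (ρ^2 / (1 + |ρ|)) / 2))) := by
    have : Real.exp (-(Complex.arg w * s.im)) * Real.exp (-(α * (Y * ρ))) ≤ Real.exp (-(π/2) * s.im) * Real.exp (-(s.im * (ρ^2 / (1 + |ρ|)) / 2)) := by
      rw [← Real.exp_add, ← Real.exp_add]
      apply Real.exp_le_exp.2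
      rw [harg, show α * (Y * ρ) = s.im * ρ by rw [htY]; ring]
      have := mul_le_mul_of_nonneg_left hat (by linarith : 0 ≤ s.im)
      linarith
    linarith
  have hdec := decay_bound n (ρ := ρ) ht1
  calc _ ≤ ((2 * (1 + |ρ|)) ^ n * Y ^ (s.re - 1)) * Real.exp (-(Complex.arg w * s.im)) * (2 * Real.exp (-(α * (Y * ρ)))) := by
        gcongr
        exact hr.trans (by gcongr)
    _ = ((2 * (1 + |ρ|)) ^ n * Y ^ (s.re - 1)) * (Real.exp (-(Complex.arg w * s.im)) * (2 * Real.exp (-(α * (Y * ρ))))) := by ring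
    _ ≤ ((2 * (1 + |ρ|)) ^ n * Y ^ (s.re - 1)) * (2 * (Real.exp (-(π/2) * s.im) * Real.exp (-(s.im * (ρ^2 / (1 + |ρ|)) / 2)))) := by gcongr
    _ = 2 * Y ^ (s.re - 1) * Real.exp (-(π/2) * s.im) * ((2 * (1 + |ρ|)) ^ n * Real.exp (-(s.im * (ρ^2 / (1 + |ρ|)) / 2))) := by ring
    _ ≤ 2 * Y ^ (s.re - 1) * Real.exp (-(π/2) * s.im) * ((2 * 4^n * (2 * ((n+2 : ℕ) + 1))^(n+2)) / (1 + s.im * ρ^2)) := by gcongr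
    _ = _ := by unfold Cn; ring

lemma seg_swap (f : ℂ → ℂ) (a b : ℂ) : seg f b a = - seg f a b := by
  unfold seg
  have h := intervalIntegral.integral_comp_sub_left (a := 0) (b := 1) (fun τ : ℝ => f (a + τ * (b - a)) * (b - a)) 1
  simp only [sub_zero, sub_self] at h
  rw [← h, ← intervalIntegral.integral_neg]
  refine intervalIntegral.integral_congr fun τ _ => ?_
  have : b + τ * (a - b) = a + ((1 - τ : ℝ) : ℂ) * (b - a) := by push_cast; ring
  simp only [this]
  ring

lemma line_bound (n m : ℕ) {s : ℂ} {α Y ρ₁ ρ₂ : ℝ} (hn : |s.re - 1| ≤ n) (ht1 : 1 ≤ s.im) (hY0 : 0 < Y) (htY : s.im = α * Y)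
    (hm : m ≤ α) (hm1 : α < m + 1) (hY : Complex.exp (Y * I) = -1) (hρ : -1/2 ≤ ρ₁) (h12 : ρ₁ ≤ ρ₂) :
    ‖seg (ff m s) ((Y * ρ₁ : ℝ) + (Y + (Y * ρ₁ : ℝ)) * I) ((Y * ρ₂ : ℝ) + (Y + (Y * ρ₂ : ℝ)) * I)‖ ≤
      2 * π * Cn n * (Y ^ s.re * s.im ^ (-(1/2) : ℝ) * Real.exp (-(π/2) * s.im)) := by
  have ht : 0 < s.im := by linarith
  set B := Cn n * Y ^ (s.re - 1) * Real.exp (-(π/2) * s.im) with hB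
  have hB0 : 0 < B := by
    have := Cn_pos n
    have := Real.rpow_pos_of_pos hY0 (s.re - 1)
    positivity
  have hsq : √s.im ^ 2 = s.im := Real.sq_sqrt ht.le
  have hst : 0 < √s.im := Real.sqrt_pos.2 ht
  set g' : ℝ → ℝ := fun τ => 2 * Y * B * ((ρ₂ - ρ₁) / (1 + (√s.im * (ρ₁ + τ * (ρ₂ - ρ₁)))^2)) with hg'
  have hcont : Continuous g' := by
    rw [hg']
    refine continuous_const.mul (continuous_const.div (by fun_prop) fun τ => ?_)
    positivity
  unfold seg
  have h1 := intervalIntegral.norm_integral_le_of_norm_le (a := 0) (b := 1) (μ := volume) zero_le_one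
    (f := fun τ : ℝ => ff m s ((((Y * ρ₁ : ℝ) + (Y + (Y * ρ₁ : ℝ)) * I)) + τ * (((Y * ρ₂ : ℝ) + (Y + (Y * ρ₂ : ℝ)) * I) - ((Y * ρ₁ : ℝ) + (Y + (Y * ρ₁ : ℝ)) * I)))
      * (((Y * ρ₂ : ℝ) + (Y + (Y * ρ₂ : ℝ)) * I) - ((Y * ρ₁ : ℝ) + (Y + (Y * ρ₁ : ℝ)) * I)))
    (g := g') (Filter.Eventually.of_forall fun τ hτ => ?_) (hcont.intervalIntegrable _ _)
  · refine h1.trans ?_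
    have h2 : ∫ τ in (0:ℝ)..1, g' τ = 2 * Y * B / √s.im * Real.arctan (√s.im * (ρ₁ + 1 * (ρ₂ - ρ₁))) - 2 * Y * B / √s.im * Real.arctan (√s.im * (ρ₁ + 0 * (ρ₂ - ρ₁))) := by
      apply intervalIntegral.integral_eq_sub_of_hasDerivAt (f := fun τ => 2 * Y * B / √s.im * Real.arctan (√s.im * (ρ₁ + τ * (ρ₂ - ρ₁)))) _ (hcont.intervalIntegrable _ _)
      intro τ _
      have d1 : HasDerivAt (fun τ : ℝ => √s.im * (ρ₁ + τ * (ρ₂ - ρ₁))) (√s.im * (ρ₂ - ρ₁)) τ := by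
        have := ((hasDerivAt_mul_const (x := τ) (ρ₂ - ρ₁)).const_add ρ₁).const_mul (√s.im)
        simpa using this
      have d2 := d1.arctan.const_mul (2 * Y * B / √s.im)
      have e : 2 * Y * B / √s.im * (1 / (1 + (√s.im * (ρ₁ + τ * (ρ₂ - ρ₁)))^2) * (√s.im * (ρ₂ - ρ₁))) = g' τ := by
        simp only [hg']
        have : 0 < 1 + (√s.im * (ρ₁ + τ * (ρ₂ - ρ₁)))^2 := by positivity
        field_simp
      rw [← e]; exact d2
    rw [h2, ← mul_sub]
    have h3 := Real.arctan_lt_pi_div_two (√s.im * (ρ₁ + 1 * (ρ₂ - ρ₁)))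
    have h4 := Real.neg_pi_div_two_lt_arctan (√s.im * (ρ₁ + 0 * (ρ₂ - ρ₁)))
    calc _ ≤ 2 * Y * B / √s.im * π := by gcongr; linarith
      _ = 2 * π * Cn n * ((Y ^ (s.re - 1) * Y) * (√s.im)⁻¹ * Real.exp (-(π/2) * s.im)) := by rw [hB]; field_simp
      _ = _ := by
        rw [← Real.rpow_add_one hY0.ne', Real.rpow_neg ht.le, ← Real.sqrt_eq_rpow]; ring_nf
  · set ρ := ρ₁ + τ * (ρ₂ - ρ₁) with hρd
    have e1 : (((Y * ρ₁ : ℝ) + (Y + (Y * ρ₁ : ℝ)) * I)) + τ * (((Y * ρ₂ : ℝ) + (Y + (Y * ρ₂ : ℝ)) * I) - ((Y * ρ₁ : ℝ) + (Y + (Y * ρ₁ : ℝ)) * I) : ℂ)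
        = ((Y * ρ : ℝ) + (Y + (Y * ρ : ℝ)) * I) := by rw [hρd]; push_cast; ring
    have e2 : (((Y * ρ₂ : ℝ) + (Y + (Y * ρ₂ : ℝ)) * I) - ((Y * ρ₁ : ℝ) + (Y + (Y * ρ₁ : ℝ)) * I) : ℂ) = ((Y * (ρ₂ - ρ₁) : ℝ) : ℂ) * (1 + I) := by push_cast; ring
    have hρ' : -1/2 ≤ ρ := by
      have := mul_nonneg hτ.1.le (sub_nonneg.2 h12)
      rw [hρd]; linarith
    rw [e1, e2, norm_mul, norm_mul, Complex.norm_of_nonneg (mul_nonneg hY0.le (sub_nonneg.2 h12))]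
    have h2 : ‖(1 + I : ℂ)‖ ≤ 2 := by
      have := norm_add_le (1:ℂ) I; simp at this; linarith
    have h3 := ff_line n m hn ht1 hY0 htY hm hm1 hY hρ'
    rw [← hB] at h3
    have hnn := sub_nonneg.2 h12
    calc _ ≤ (B / (1 + s.im * ρ^2)) * (Y * (ρ₂ - ρ₁) * 2) := by gcongr
      _ = _ := by
        show _ = 2 * Y * B * ((ρ₂ - ρ₁) / (1 + (√s.im * ρ)^2))
        rw [mul_pow, hsq]; field_simp



def Dn (n : ℕ) : ℝ := 4^(2*n+1) * (2 * ((2*n+1 : ℕ) + 1))^(2*n+1)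
lemma Dn_pos (n : ℕ) : 0 < Dn n := by unfold Dn; positivity

lemma small_bound (n : ℕ) {Y t σ : ℝ} (hn : |σ - 1| ≤ n) (ht1 : 1 ≤ t) (hY1 : 1 ≤ Y) (hY2 : Y ≤ 2 * t) :
    Y^(n+1) * Real.exp (t/2 - 3*π/4*t) ≤ Dn n * (Y ^ σ * t ^ (-(1/2) : ℝ) * Real.exp (-(π/2) * t)) := by
  have hpi := Real.pi_gt_three
  have hY0 : 0 < Y := by linarith
  have h1 : Y^(n+1) ≤ Y^σ * (1+2*t)^(2*n) := by
    have e : Y^(n+1) = Y^σ * Y^((n+1:ℝ) - σ) := by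
      rw [← Real.rpow_add hY0, ← Real.rpow_natCast]; push_cast; congr 1; ring
    rw [e]
    have : Y^((n+1:ℝ) - σ) ≤ Y^(2*n) := by
      rw [← Real.rpow_natCast]
      apply Real.rpow_le_rpow_of_exponent_le hY1
      push_cast
      have := (abs_le.1 hn).1
      linarith
    gcongr
    exact this.trans (by gcongr; linarith)
  have h2 : 1 ≤ t ^ (-(1/2) : ℝ) * (1 + 2*t) := by
    have : t ^ (-(1/2) : ℝ) * t = t ^ (1/2 : ℝ) := by
      rw [← Real.rpow_add_one (by linarith)]; norm_num
    have h3 : 1 ≤ t ^ (1/2 : ℝ) := Real.one_le_rpow ht1 (by norm_num)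
    have h4 : 0 < t ^ (-(1/2) : ℝ) := by positivity
    nlinarith
  have h3 : Real.exp (t/2 - 3*π/4*t) ≤ Real.exp (-(π/2) * t) * Real.exp (-(t/4)) := by
    rw [← Real.exp_add]; apply Real.exp_le_exp.2; nlinarith
  have h4 := pow_exp_bound (2*n+1) (X := t/2) (by linarith)
  have h5 : (1+2*t)^(2*n+1) * Real.exp (-(t/4)) ≤ Dn n := by
    have e : Real.exp (t/2/2) * Real.exp (-(t/4)) = 1 := by rw [← Real.exp_add]; ring_nf; simp
    calc _ ≤ (4 * (1+t/2))^(2*n+1) * Real.exp (-(t/4)) := by gcongr; linarith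
      _ = 4^(2*n+1) * (1+t/2)^(2*n+1) * Real.exp (-(t/4)) := by rw [mul_pow]
      _ ≤ 4^(2*n+1) * ((2 * ((2*n+1 : ℕ) + 1))^(2*n+1) * Real.exp (t/2/2)) * Real.exp (-(t/4)) := by gcongr
      _ = Dn n * (Real.exp (t/2/2) * Real.exp (-(t/4))) := by unfold Dn; ring
      _ = _ := by rw [e, mul_one]
  have hYs : 0 < Y^σ := by positivity
  have htp : 0 < t ^ (-(1/2) : ℝ) := by positivity
  calc _ ≤ (Y^σ * (1+2*t)^(2*n)) * (Real.exp (-(π/2) * t) * Real.exp (-(t/4))) := by gcongr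
    _ = (Y^σ * (1+2*t)^(2*n)) * (Real.exp (-(π/2) * t) * Real.exp (-(t/4))) * 1 := by ring
    _ ≤ (Y^σ * (1+2*t)^(2*n)) * (Real.exp (-(π/2) * t) * Real.exp (-(t/4))) * (t ^ (-(1/2) : ℝ) * (1 + 2*t)) := by gcongr
    _ = (Y ^ σ * t ^ (-(1/2) : ℝ) * Real.exp (-(π/2) * t)) * ((1+2*t)^(2*n+1) * Real.exp (-(t/4))) := by ring
    _ ≤ (Y ^ σ * t ^ (-(1/2) : ℝ) * Real.exp (-(π/2) * t)) * Dn n := by gcongr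
    _ = _ := by ring

lemma rr_ge : 7/10 ≤ rr := by
  unfold rr
  have : (1.4:ℝ) ≤ √2 := by apply Real.le_sqrt_of_sq_le; norm_num
  linarith

lemma rr_sq : rr^2 = 1/2 := by
  unfold rr; rw [div_pow, Real.sq_sqrt (by norm_num)]; norm_num

lemma arg_ray {x : ℝ} (hx : 0 < x) : Complex.arg (-x + x * I) = 3*π/4 := by
  have h : (-x + x * I : ℂ).im = x := by simp
  have h' : (-x + x * I : ℂ).re = -x := by simp
  rw [arg_of_upper (by rw [h]; exact hx), h, h', neg_div, div_self hx.ne', Real.arctan_neg, Real.arctan_one]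
  ring

lemma norm_ray {x : ℝ} (hx : 0 < x) : ‖(-x + x * I : ℂ)‖ = √2 * x := by
  have : (-x + x * I : ℂ) = (x:ℂ) * (-1 + I) := by ring
  rw [this, norm_mul, Complex.norm_of_nonneg hx.le, mul_comm]
  congr 1
  rw [Complex.norm_def]; simp [Complex.normSq]; norm_num

lemma ff_ray (n m : ℕ) {s : ℂ} {α Y x : ℝ} (hn : |s.re - 1| ≤ n) (ht1 : 1 ≤ s.im) (htY : s.im = α * Y)
    (hm : m ≤ α) (hx : rr ≤ x) (hxY : x ≤ Y/2) :
    ‖ff m s (-x + x * I)‖ ≤ 4 * Y^n * Real.exp (s.im/2 - 3*π/4*s.im) := by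
  have hr := rr_ge
  have hx0 : 0 < x := by linarith
  have hY0 : 0 < Y := by linarith
  have hw : (-x + x * I : ℂ) ≠ 0 := by
    intro h
    have := norm_ray hx0
    rw [h, norm_zero] at this
    have : 0 < √2 * x := by positivity
    linarith
  rw [norm_ff m s hw, arg_ray hx0, norm_ray hx0]
  have hs2 : (√2)^2 = 2 := Real.sq_sqrt (by norm_num)
  have hs2' : 0 < √2 := by positivity
  have h1 : 1 ≤ √2 * x := by
    have : √2 * rr = 1 := by unfold rr; nlinarith
    nlinarith
  have h2 : √2 * x ≤ Y := by
    have : √2 ≤ 2 := by nlinarith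
    nlinarith
  have h3 : (√2 * x)^(s.re - 1) ≤ Y^n := by
    calc (√2 * x)^(s.re - 1) ≤ (√2 * x)^(n:ℝ) := Real.rpow_le_rpow_of_exponent_le h1 ((le_abs_self _).trans hn)
      _ ≤ Y^(n:ℝ) := by gcongr
      _ = _ := Real.rpow_natCast _ _
  have h4 : ‖KK m (-x + x * I)‖ ≤ 4 * Real.exp (s.im/2) := by
    unfold KK
    rw [norm_div, Complex.norm_exp]
    have e1 : (-(m:ℂ) * (-x + x * I)).re = m * x := by simp
    have e2 : 1 - Real.exp (-x) ≤ ‖Complex.exp (-x + x * I) - 1‖ := by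
      have := norm_sub_norm_le (1:ℂ) (Complex.exp (-x + x * I))
      rw [norm_one, Complex.norm_exp, norm_sub_rev] at this
      simpa using this
    have e3 : Real.exp (-x) ≤ 3/4 := by
      rw [Real.exp_neg]
      have := Real.add_one_le_exp x
      rw [inv_le_comm₀ (Real.exp_pos _) (by norm_num)]
      linarith
    have e4 : Real.exp (m * x) ≤ Real.exp (s.im/2) := by
      apply Real.exp_le_exp.2
      rw [htY]
      have h0 : (0:ℝ) ≤ m := Nat.cast_nonneg m
      nlinarith [mul_le_mul_of_nonneg_right hm hx0.le, mul_le_mul_of_nonneg_left hxY (h0.trans hm)]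
    rw [e1, div_le_iff₀ (by linarith)]
    have := Real.exp_pos (s.im/2)
    nlinarith
  calc _ ≤ Y^n * Real.exp (-(3*π/4*s.im)) * (4 * Real.exp (s.im/2)) := by gcongr
    _ = _ := by rw [Real.exp_sub, Real.exp_neg]; field_simp

lemma seg_ray (n m : ℕ) {s : ℂ} {α Y : ℝ} (hn : |s.re - 1| ≤ n) (ht1 : 1 ≤ s.im) (htY : s.im = α * Y)
    (hm : m ≤ α) (hY2 : 2 ≤ Y) :
    ‖seg (ff m s) (-(Y/2) + (Y/2) * I) (-rr + rr * I)‖ ≤ 8 * (Y^(n+1) * Real.exp (s.im/2 - 3*π/4*s.im)) := by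
  unfold seg
  have hr := rr_lt
  have hr0 := rr_pos
  have h := intervalIntegral.norm_integral_le_of_norm_le_const (a := 0) (b := 1) (C := 8 * (Y^(n+1) * Real.exp (s.im/2 - 3*π/4*s.im)))
    (f := fun τ : ℝ => ff m s (-(Y/2) + (Y/2) * I + τ * (-rr + rr * I - (-(Y/2) + (Y/2) * I))) * (-rr + rr * I - (-(Y/2) + (Y/2) * I))) ?_
  · simpa using h
  · intro τ hτ
    rw [Set.uIoc_of_le zero_le_one] at hτ
    set x := Y/2 + τ * (rr - Y/2) with hx
    have e : (-(Y/2) + (Y/2) * I + τ * (-rr + rr * I - (-(Y/2) + (Y/2) * I)) : ℂ) = -x + x * I := by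
      rw [hx]; push_cast; ring
    have e2 : (-rr + rr * I - (-(Y/2) + (Y/2) * I) : ℂ) = ((Y/2 - rr : ℝ) : ℂ) * (1 - I) := by push_cast; ring
    rw [e, e2, norm_mul, norm_mul, Complex.norm_of_nonneg (by linarith)]
    have h1 := ff_ray n m (x := x) hn ht1 htY hm (by rw [hx]; nlinarith [hτ.1, hτ.2]) (by rw [hx]; nlinarith [hτ.1, hτ.2])
    have h2 : ‖(1 - I : ℂ)‖ ≤ 2 := by
      have := norm_sub_le (1:ℂ) I; simp at this; linarith
    calc _ ≤ (4 * Y^n * Real.exp (s.im/2 - 3*π/4*s.im)) * (Y * 2) := by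
          have h3 : (Y/2 - rr) * ‖(1 - I : ℂ)‖ ≤ Y * 2 := by
            have h5 := norm_nonneg (1 - I : ℂ)
            nlinarith
          have h4 : 0 ≤ (Y/2 - rr) * ‖(1 - I : ℂ)‖ := mul_nonneg (by linarith) (norm_nonneg _)
          exact mul_le_mul h1 h3 h4 (by positivity)
      _ = _ := by ring

lemma KK_circ_bound : ∃ C0 > 0, ∀ m : ℕ, ∀ θ ∈ Set.Icc (0:ℝ) (2*π), ‖KK m (Complex.exp (θ * I))‖ ≤ Real.exp m * C0 := by
  obtain ⟨C, hC⟩ := (isCompact_Icc (a := (0:ℝ)) (b := 2*π)).exists_bound_of_continuousOn (KK_circ_cont 0).continuousOn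
  refine ⟨max C 1, by positivity, fun m θ hθ => ?_⟩
  have e : KK m (Complex.exp (θ * I)) = Complex.exp (-(m:ℂ) * Complex.exp (θ * I)) * KK 0 (Complex.exp (θ * I)) := by
    unfold KK; simp [div_eq_mul_inv]
  rw [e, norm_mul, Complex.norm_exp]
  have h1 : (-(m:ℂ) * Complex.exp (θ * I)).re ≤ m := by
    have h := (le_abs_self _).trans (Complex.abs_re_le_norm (-(m:ℂ) * Complex.exp (θ * I)))
    rw [norm_mul, Complex.norm_exp_ofReal_mul_I] at h
    simpa using h
  gcongr
  exact (hC θ hθ).trans (le_max_left _ _)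

lemma circ_piece {C0 : ℝ} (h0 : 0 < C0) (hC : ∀ m : ℕ, ∀ θ ∈ Set.Icc (0:ℝ) (2*π), ‖KK m (Complex.exp (θ * I))‖ ≤ Real.exp m * C0)
    (m : ℕ) {s : ℂ} (ht : 0 < s.im) {a : ℝ} (ha0 : 0 ≤ a) (ha : a ≤ 2*π) :
    ‖∫ θ in a..(2*π), Complex.exp (s * (θ * I)) * KK m (Complex.exp (θ * I))‖ ≤ 2*π * C0 * Real.exp m * Real.exp (-(a * s.im)) := by
  have h := intervalIntegral.norm_integral_le_of_norm_le_const (a := a) (b := 2*π) (C := Real.exp (-(a * s.im)) * (Real.exp m * C0))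
    (f := fun θ : ℝ => Complex.exp (s * (θ * I)) * KK m (Complex.exp (θ * I))) ?_
  · refine h.trans ?_
    rw [abs_of_nonneg (by linarith)]
    calc _ ≤ Real.exp (-(a * s.im)) * (Real.exp m * C0) * (2*π) := by gcongr; linarith
      _ = _ := by ring
  · intro θ hθ
    rw [Set.uIoc_of_le ha] at hθ
    rw [norm_mul, Complex.norm_exp]
    have e : (s * (θ * I)).re = -(θ * s.im) := by simp; ring
    rw [e]
    have := hC m θ ⟨by linarith [hθ.1], hθ.2⟩
    gcongr
    exact hθ.1.le

lemma exp_half (M : ℕ) (Y : ℝ) (hY : Y = 2 * π * (M + 1/2)) : Complex.exp (Y * I) = -1 := by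
  have : (Y * I : ℂ) = M * (2 * π * I) + π * I := by rw [hY]; push_cast; ring
  rw [this, Complex.exp_add, Complex.exp_nat_mul_two_pi_mul_I, Complex.exp_pi_mul_I, one_mul]

lemma B1 (n : ℕ) : ∃ C > 0, ∀ (m M : ℕ) (s : ℂ) (α Y : ℝ), |s.re - 1| ≤ n → 1 ≤ s.im → 1 ≤ M → Y = 2 * π * (M + 1/2) →
    s.im = α * Y → 1/2 ≤ α → m ≤ α → α < m + 1 →
    ‖Complex.Gamma s * (riemannZeta s - ∑ n ∈ Finset.Icc 1 m, (n:ℂ) ^ (-s)) - 2 * π * I * ∑ v ∈ Finset.Icc 1 M, (2 * π * I * v : ℂ) ^ (s - 1)‖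
      ≤ C * (Y ^ s.re * s.im ^ (-(1/2) : ℝ) * Real.exp (-(π/2) * s.im)) := by
  obtain ⟨C0, hC0, hC⟩ := KK_circ_bound
  have hpi := Real.pi_gt_three
  have hpi4 := Real.pi_lt_four
  have hCn := Cn_pos n
  have hDn := Dn_pos n
  refine ⟨2 * (2 * π * Cn n) + (8 + 2 * π * C0 + 4 * π * C0) * Dn n, by positivity, ?_⟩
  intro m M s α Y hn ht1 hM hY htY hα hm hm1
  have ht : 0 < s.im := by linarith
  have hM' : (1:ℝ) ≤ M := by exact_mod_cast hM
  have hY9 : 9 ≤ Y := by rw [hY]; nlinarith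
  have hY0 : 0 < Y := by linarith
  have hY2t : Y ≤ 2 * s.im := by rw [htY]; nlinarith
  have hYe := exp_half M Y hY
  set T := Y ^ s.re * s.im ^ (-(1/2) : ℝ) * Real.exp (-(π/2) * s.im) with hT
  have hsm := small_bound n hn ht1 (by linarith : 1 ≤ Y) hY2t
  rw [← hT] at hsm
  set S := Y^(n+1) * Real.exp (s.im/2 - 3*π/4*s.im) with hS
  have hmt : (m:ℝ) ≤ s.im/2 := by
    have h0 : (0:ℝ) ≤ m := Nat.cast_nonneg m
    rw [htY]; nlinarith
  have hmS : Real.exp m * Real.exp (-(3*π/4*s.im)) ≤ S := by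
    rw [hS, ← Real.exp_add]
    have : Real.exp (m + -(3*π/4*s.im)) ≤ Real.exp (s.im/2 - 3*π/4*s.im) := Real.exp_le_exp.2 (by linarith)
    have h1 : 1 ≤ Y^(n+1) := one_le_pow₀ (by linarith)
    have := Real.exp_pos (s.im/2 - 3*π/4*s.im)
    nlinarith
  -- pieces
  have hmove := move m M hM s ht Y hY
  set L := tailI m s - arcI m s - 2 * π * I * ∑ v ∈ Finset.Icc 1 M, (2 * π * I * v : ℂ) ^ (s - 1)
        + seg (ff m s) (1 + (Y + 1) * I) (-(Y/2) + (Y/2) * I) + seg (ff m s) (-(Y/2) + (Y/2) * I) (-rr + rr * I) with hL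
  have hLb : ‖L‖ ≤ 2 * π * Cn n * T := by
    refine le_of_tendsto hmove.norm ?_
    filter_upwards [Filter.eventually_ge_atTop (1:ℝ)] with X hX
    have := line_bound n m (ρ₁ := 1/Y) (ρ₂ := X/Y) hn ht1 hY0 htY hm hm1 hYe (by have : 0 < 1/Y := by positivity
                                                                                 linarith) (by gcongr)
    rw [mul_div_cancel₀ _ hY0.ne', mul_div_cancel₀ _ hY0.ne'] at this
    rw [← hT, Complex.ofReal_one] at this
    exact this
  have hs1 : ‖seg (ff m s) (1 + (Y + 1) * I) (-(Y/2) + (Y/2) * I)‖ ≤ 2 * π * Cn n * T := by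
    rw [seg_swap, norm_neg]
    have := line_bound n m (ρ₁ := -1/2) (ρ₂ := 1/Y) hn ht1 hY0 htY hm hm1 hYe le_rfl (by have : 0 < 1/Y := by positivity
                                                                                         linarith)
    rw [mul_div_cancel₀ _ hY0.ne'] at this
    have e : (((Y * (-1/2) : ℝ) : ℂ) + (Y + ((Y * (-1/2) : ℝ) : ℂ)) * I) = (-(Y/2) + (Y/2) * I) := by push_cast; ring
    rw [e, ← hT, Complex.ofReal_one] at this
    exact this
  have hs2 := seg_ray n m hn ht1 htY hm (by linarith)
  rw [← hS] at hs2
  set E := Complex.exp (2 * π * I * s) with hE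
  have hE1 := exp_two_pi_ne ht
  rw [← hE] at hE1
  set A2 := ∫ θ in (3*π/4)..(2*π), Complex.exp (s * (θ * I)) * KK m (Complex.exp (θ * I)) with hA2
  have hcirc : circI m s = arcI m s + I * A2 := by
    unfold circI arcI
    rw [hA2, ← mul_add, intervalIntegral.integral_add_adjacent_intervals]
    all_goals
      have hk := KK_circ_cont m
      exact (Continuous.mul (by fun_prop) hk).intervalIntegrable _ _
  have hA2b : ‖A2‖ ≤ 2 * π * C0 * S := by
    refine (circ_piece hC0 hC m ht (by positivity) (by linarith)).trans ?_
    rw [mul_assoc]; gcongr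
  have hEn : ‖E‖ = Real.exp (-(2*π*s.im)) := by
    rw [hE, Complex.norm_exp]; congr 1; simp
  have hEl : 1/2 ≤ ‖E - 1‖ := by
    have := norm_sub_norm_le (1:ℂ) E
    rw [norm_one, norm_sub_rev, hEn] at this
    have h3 : Real.exp (-(2*π*s.im)) ≤ 1/2 := by
      rw [Real.exp_neg]
      have := Real.add_one_le_exp (2*π*s.im)
      rw [inv_le_comm₀ (Real.exp_pos _) (by norm_num)]
      nlinarith
    linarith
  have hcb : ‖circI m s‖ ≤ 2 * π * C0 * Real.exp m := by
    have := circ_piece hC0 hC m ht (le_refl 0) (by positivity)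
    unfold circI
    rw [norm_mul, Complex.norm_I, one_mul]
    simpa using this
  have hcE : ‖circI m s * E / (E - 1)‖ ≤ 4 * π * C0 * S := by
    rw [norm_div, norm_mul, hEn, div_le_iff₀ (by linarith)]
    have h1 : Real.exp (-(2*π*s.im)) ≤ Real.exp (-(3*π/4*s.im)) := by
      apply Real.exp_le_exp.2; nlinarith
    have hS0 : 0 < S := by positivity
    calc _ ≤ 2 * π * C0 * Real.exp m * Real.exp (-(3*π/4*s.im)) := by gcongr
      _ = 2 * π * C0 * (Real.exp m * Real.exp (-(3*π/4*s.im))) := by ring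
      _ ≤ 2 * π * C0 * S := by gcongr
      _ = 4 * π * C0 * S * (1/2) := by ring
      _ ≤ _ := by gcongr
  have key : Complex.Gamma s * (riemannZeta s - ∑ n ∈ Finset.Icc 1 m, (n:ℂ) ^ (-s)) - 2 * π * I * ∑ v ∈ Finset.Icc 1 M, (2 * π * I * v : ℂ) ^ (s - 1)
      = L - seg (ff m s) (1 + (Y + 1) * I) (-(Y/2) + (Y/2) * I) - seg (ff m s) (-(Y/2) + (Y/2) * I) (-rr + rr * I)
        - I * A2 + circI m s * E / (E - 1) := by
    rw [hankel m ht, ← hE]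
    have : circI m s / (E - 1) = - circI m s + circI m s * E / (E - 1) := by field_simp; ring
    rw [this, hL, hcirc]; ring
  rw [key]
  have hIA : ‖I * A2‖ ≤ 2 * π * C0 * S := by rw [norm_mul, Complex.norm_I, one_mul]; exact hA2b
  have t1 := norm_add_le (L - seg (ff m s) (1 + (Y + 1) * I) (-(Y/2) + (Y/2) * I) - seg (ff m s) (-(Y/2) + (Y/2) * I) (-rr + rr * I)
        - I * A2) (circI m s * E / (E - 1))
  have t2 := norm_sub_le (L - seg (ff m s) (1 + (Y + 1) * I) (-(Y/2) + (Y/2) * I) - seg (ff m s) (-(Y/2) + (Y/2) * I) (-rr + rr * I)) (I * A2)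
  have t3 := norm_sub_le (L - seg (ff m s) (1 + (Y + 1) * I) (-(Y/2) + (Y/2) * I)) (seg (ff m s) (-(Y/2) + (Y/2) * I) (-rr + rr * I))
  have t4 := norm_sub_le L (seg (ff m s) (1 + (Y + 1) * I) (-(Y/2) + (Y/2) * I))
  have hfin : (8 + 2 * π * C0 + 4 * π * C0) * S ≤ (8 + 2 * π * C0 + 4 * π * C0) * (Dn n * T) := by gcongr
  linarith



lemma chi_eq (s : ℂ) : chi s = Gammaℝ (1 - s) / Gammaℝ s := by
  have hpi : (π:ℂ) ≠ 0 := Complex.ofReal_ne_zero.2 Real.pi_ne_zero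
  unfold chi
  rw [Gammaℝ_def, Gammaℝ_def]
  have e : (s - 1/2 : ℂ) = -(1-s)/2 - -s/2 := by ring
  rw [e, Complex.cpow_sub _ _ hpi]
  field_simp

lemma GammaR_ne {s : ℂ} (hs : s ∈ RSOmega) : Gammaℝ s ≠ 0 := by
  rcases hs with h | h
  · rw [Ne, Gammaℝ_eq_zero_iff]
    rintro ⟨n, hn⟩
    apply h; rw [hn]; simp
  · exact Gammaℝ_ne_zero_of_re_pos h.1

lemma RS_one_sub {s : ℂ} (hs : s ∈ RSOmega) : 1 - s ∈ RSOmega := by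
  rcases hs with h | h
  · left; simpa using h
  · right; simp; exact ⟨h.2, h.1⟩

lemma chi_mul {s : ℂ} (hs : s ∈ RSOmega) : chi s * chi (1 - s) = 1 := by
  have h1 := GammaR_ne hs
  have h2 := GammaR_ne (RS_one_sub hs)
  rw [chi_eq, chi_eq, sub_sub_cancel]
  field_simp

lemma chi_form {s : ℂ} (ht : s.im ≠ 0) :
    chi s * (1 + Complex.exp (π * I * s)) * Complex.Gamma s = (2 * π : ℂ) ^ s * Complex.exp (π * I * s / 2) := by
  have hs : s ∈ RSOmega := Or.inl ht
  have h1 := GammaR_ne hs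
  have h2 := GammaR_ne (RS_one_sub hs)
  have h := inv_Gammaℝ_one_sub (s := s) (by rintro n hn; apply ht; rw [hn]; simp)
  have hpi : (2 * π:ℂ) ≠ 0 := mul_ne_zero two_ne_zero (Complex.ofReal_ne_zero.2 Real.pi_ne_zero)
  have h3 : chi s * (Gammaℂ s * Complex.cos (π * s / 2)) = 1 := by
    rw [chi_eq]
    have : Gammaℝ (1 - s) * (Gammaℂ s * Complex.cos (π * s / 2) * (Gammaℝ s)⁻¹) = 1 := by
      rw [← h, mul_inv_cancel₀ h2]
    rw [div_eq_mul_inv]; linear_combination this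
  rw [Gammaℂ_def, Complex.cpow_neg] at h3
  have hp : (2 * π : ℂ) ^ s ≠ 0 := by rw [Complex.cpow_def_of_ne_zero hpi]; exact Complex.exp_ne_zero _
  have hc : 2 * Complex.cos (π * s / 2) * Complex.exp (π * I * s / 2) = 1 + Complex.exp (π * I * s) := by
    rw [Complex.two_cos, add_mul, ← Complex.exp_add, ← Complex.exp_add]
    rw [show π * s / 2 * I + π * I * s / 2 = π * I * s by ring, show -(π * s / 2) * I + π * I * s / 2 = 0 by ring, Complex.exp_zero]
    ring
  rw [← hc]
  have h4 : chi s * (2 * Complex.Gamma s * Complex.cos (π * s / 2)) = (2 * π : ℂ) ^ s := by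
    have : (2 * π : ℂ) ^ s * (chi s * (2 * ((2 * π : ℂ) ^ s)⁻¹ * Complex.Gamma s * Complex.cos (π * s / 2))) = (2 * π : ℂ) ^ s := by
      rw [h3, mul_one]
    rw [← this]; field_simp
  rw [← h4]; ring

lemma zeta_fe {s : ℂ} (ht : s.im ≠ 0) : riemannZeta s = chi s * riemannZeta (1 - s) := by
  have hs : s ∈ RSOmega := Or.inl ht
  have h1 := GammaR_ne hs
  have h2 := GammaR_ne (RS_one_sub hs)
  have hn0 : s ≠ 0 := by rintro rfl; simp at ht
  have hn1 : 1 - s ≠ 0 := by intro h; apply ht; rw [← sub_eq_zero.1 h]; simp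
  rw [riemannZeta_def_of_ne_zero hn0, riemannZeta_def_of_ne_zero hn1, completedRiemannZeta_one_sub, chi_eq]
  field_simp

lemma exp_pi_norm (s : ℂ) : ‖Complex.exp (π * I * s)‖ = Real.exp (-(π * s.im)) := by
  rw [Complex.norm_exp]; congr 1; simp

lemma exp_pi_small {s : ℂ} (ht : 1 ≤ s.im) : Real.exp (-(π * s.im)) ≤ 1/2 := by
  have hpi := Real.pi_gt_three
  rw [Real.exp_neg]
  have := Real.add_one_le_exp (π * s.im)
  rw [inv_le_comm₀ (Real.exp_pos _) (by norm_num)]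
  nlinarith

lemma one_add_lower {s : ℂ} (ht : 1 ≤ s.im) : 1/2 ≤ ‖1 + Complex.exp (π * I * s)‖ := by
  have h := norm_sub_norm_le (1:ℂ) (-Complex.exp (π * I * s))
  rw [norm_neg, exp_pi_norm, norm_one, sub_neg_eq_add] at h
  linarith [exp_pi_small ht]

lemma one_add_upper {s : ℂ} (ht : 1 ≤ s.im) : ‖1 + Complex.exp (π * I * s)‖ ≤ 2 := by
  have h := norm_add_le (1:ℂ) (Complex.exp (π * I * s))
  rw [exp_pi_norm, norm_one] at h
  linarith [exp_pi_small ht]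

lemma two_pi_norm (s : ℂ) : ‖(2 * π : ℂ) ^ s‖ = (2*π)^s.re := by
  have : (2 * π : ℂ) = ((2 * π : ℝ) : ℂ) := by push_cast; ring
  rw [this, Complex.norm_cpow_eq_rpow_re_of_pos (by positivity)]

lemma chi_norm_eq {s : ℂ} (ht : 1 ≤ s.im) :
    ‖chi s‖ * ‖1 + Complex.exp (π * I * s)‖ * ‖Complex.Gamma s‖ = (2*π)^s.re * Real.exp (-(π/2) * s.im) := by
  have h := congrArg norm (chi_form (s := s) (by linarith))
  rw [norm_mul, norm_mul, norm_mul, two_pi_norm] at h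
  rw [h, Complex.norm_exp]
  congr 2
  rw [show (π * I * s / 2 : ℂ) = ((π/2 : ℝ):ℂ) * (I * s) by push_cast; ring, Complex.re_ofReal_mul]
  simp

lemma rpow_split {t σ : ℝ} (ht : 0 < t) : t^(1/2 - σ) * t^(σ - 1/2) = 1 := by
  rw [← Real.rpow_add ht]; simp

lemma chi_bounds (A B : ℝ) : ∃ C > 0, ∀ s : ℂ, A ≤ s.re → s.re ≤ B → 1 ≤ s.im →
    ‖chi s‖ ≤ C * s.im^(1/2 - s.re) ∧ s.im^(1/2 - s.re) ≤ C * ‖chi s‖ := by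
  obtain ⟨C1, hC1, h1⟩ := Gamma_upper A B
  obtain ⟨C2', hC2', h2'⟩ := Gamma_lower A B
  obtain ⟨C2, hC2, h2⟩ : ∃ C2 > 0, ∀ s : ℂ, A ≤ s.re → s.re ≤ B → 1 ≤ s.im →
      s.im ^ (s.re - 1/2) * Real.exp (-(π/2) * s.im) ≤ C2 * ‖Complex.Gamma s‖ := by
    refine ⟨C2'⁻¹, by positivity, fun s a b c => ?_⟩
    rw [inv_mul_eq_div, le_div_iff₀ hC2']
    linarith [h2' s a b c]
  have hpi := Real.pi_gt_three
  have hA : 0 < (2*π)^A := by positivity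
  have hB : 0 < (2*π)^B := by positivity
  refine ⟨2 * (2*π)^B * C2 + 2 * C1 / (2*π)^A, by positivity, fun s ha hb ht => ?_⟩
  have ht0 : 0 < s.im := by linarith
  have e := chi_norm_eq ht
  have g1 := h1 s ha hb ht
  have g2 := h2 s ha hb ht
  have l1 := one_add_lower ht
  have l2 := one_add_upper ht
  have p1 : (2*π)^A ≤ (2*π)^s.re := Real.rpow_le_rpow_of_exponent_le (by linarith) ha
  have p2 : (2*π)^s.re ≤ (2*π)^B := Real.rpow_le_rpow_of_exponent_le (by linarith) hb
  have hsp := rpow_split (σ := s.re) ht0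
  set E := Real.exp (-(π/2) * s.im) with hE
  have hE0 : 0 < E := Real.exp_pos _
  set R := s.im^(1/2 - s.re)
  set R' := s.im^(s.re - 1/2)
  have hR : 0 < R := by positivity
  have hR' : 0 < R' := by positivity
  set g := ‖Complex.Gamma s‖
  set x := ‖chi s‖
  have hx : 0 ≤ x := norm_nonneg _
  set q := ‖1 + Complex.exp (π * I * s)‖
  -- R' E ≤ C2 g ; g ≤ C1 R' E
  have u : x ≤ 2 * (2*π)^B * C2 * R := by
    have k1 : x * (1/2) * (R' * E) ≤ C2 * ((2*π)^B * E) := by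
      calc x * (1/2) * (R' * E) ≤ x * q * (C2 * g) := by gcongr
        _ = C2 * (x * q * g) := by ring
        _ = C2 * ((2*π)^s.re * E) := by rw [e]
        _ ≤ _ := by gcongr
    have k2 : x * (1/2) * R' ≤ C2 * (2*π)^B := by
      apply le_of_mul_le_mul_right _ hE0; linarith
    calc x = 2 * R * (x * (1/2) * R') := by linear_combination -x * hsp
      _ ≤ 2 * R * (C2 * (2*π)^B) := by gcongr
      _ = _ := by ring
  have l : R ≤ 2 * C1 / (2*π)^A * x := by
    have k1 : (2*π)^A * E ≤ 2 * C1 * x * R' * E := by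
      calc (2*π)^A * E ≤ (2*π)^s.re * E := by gcongr
        _ = x * q * g := e.symm
        _ ≤ x * 2 * (C1 * R' * E) := by gcongr
        _ = _ := by ring
    have k2 := le_of_mul_le_mul_right k1 hE0
    rw [div_mul_eq_mul_div, le_div_iff₀ hA]
    calc R * (2*π)^A ≤ R * (2 * C1 * x * R') := by gcongr
      _ = _ := by linear_combination (2 * C1 * x) * hsp
  constructor
  · refine u.trans ?_
    gcongr
    have : 0 ≤ 2 * C1 / (2*π)^A := by positivity
    linarith
  · refine l.trans ?_
    gcongr
    have : 0 ≤ 2 * (2*π)^B * C2 := by positivity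
    linarith

lemma pole_term {s : ℂ} (ht : s.im ≠ 0) (v : ℕ) (hv : 1 ≤ v) :
    2 * π * I * (2 * π * I * v : ℂ) ^ (s - 1) = chi s * (1 + Complex.exp (π * I * s)) * Complex.Gamma s * (v:ℂ)^(-(1-s)) := by
  have hpi : (2 * π:ℂ) ≠ 0 := mul_ne_zero two_ne_zero (Complex.ofReal_ne_zero.2 Real.pi_ne_zero)
  have hv0 : (0:ℝ) < v := by exact_mod_cast hv
  have hvc : (v:ℂ) ≠ 0 := by exact_mod_cast hv0.ne'
  have hw : (2 * π * I * v : ℂ) ≠ 0 := mul_ne_zero (mul_ne_zero hpi I_ne_zero) hvc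
  have h2pi : Complex.log (2 * π : ℂ) = (Real.log (2*π) : ℝ) := by
    rw [Complex.ofReal_log (by positivity)]; push_cast; rfl
  have hlv : Complex.log (v : ℂ) = (Real.log v : ℝ) := by
    rw [Complex.ofReal_log hv0.le]; push_cast; rfl
  have hlw : Complex.log (2 * π * I * v : ℂ) = (Real.log (2*π) : ℝ) + (Real.log v : ℝ) + π / 2 * I := by
    rw [show (2 * π * I * v : ℂ) = ((2 * π * v : ℝ) : ℂ) * I by push_cast; ring,
      Complex.log_ofReal_mul (by positivity) I_ne_zero, Complex.log_I, Real.log_mul (by positivity) hv0.ne']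
    push_cast; ring
  have h2 : (2 * π * I : ℂ) = Complex.exp ((Real.log (2*π) : ℝ) + π / 2 * I) := by
    rw [Complex.exp_add, Complex.exp_pi_div_two_mul_I, ← h2pi, Complex.exp_log hpi]
  rw [chi_form ht, Complex.cpow_def_of_ne_zero hw, Complex.cpow_def_of_ne_zero hpi, Complex.cpow_def_of_ne_zero hvc, hlw, h2pi, hlv]
  nth_rewrite 1 [h2]
  rw [← Complex.exp_add, ← Complex.exp_add, ← Complex.exp_add]
  congr 1; ring

lemma exp_poly (N : ℕ) {t : ℝ} (ht : 0 < t) : (1 + 2 * t)^N * Real.exp (-(π * t)) ≤ 4^N * (2 * (N + 1))^N := by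
  have hpi := Real.pi_gt_three
  have h4 := pow_exp_bound N (X := t/2) (by linarith)
  have e : Real.exp (t/2/2) * Real.exp (-(π * t)) ≤ 1 := by
    rw [← Real.exp_add]; apply Real.exp_le_one_iff.2; nlinarith
  calc _ ≤ (4 * (1+t/2))^N * Real.exp (-(π * t)) := by gcongr; linarith
    _ = 4^N * (1+t/2)^N * Real.exp (-(π * t)) := by rw [mul_pow]
    _ ≤ 4^N * ((2 * (N + 1))^N * Real.exp (t/2/2)) * Real.exp (-(π * t)) := by gcongr
    _ = 4^N * (2 * (N + 1))^N * (Real.exp (t/2/2) * Real.exp (-(π * t))) := by ring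
    _ ≤ 4^N * (2 * (N + 1))^N * 1 := by gcongr
    _ = _ := by ring

set_option maxHeartbeats 1000000 in
lemma Core1 (n : ℕ) : ∃ C > 0, ∀ (m M : ℕ) (s : ℂ) (α : ℝ), |s.re| + 1 ≤ n → 1 ≤ s.im → 1 ≤ M →
    s.im = α * (2 * π * (M + 1/2)) → 1/2 ≤ α → m ≤ α → α < m + 1 →
    ‖riemannZeta s - ∑ k ∈ Finset.Icc 1 m, (k:ℂ) ^ (-s) - chi s * ∑ v ∈ Finset.Icc 1 M, (v : ℂ) ^ (-(1 - s))‖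
      ≤ C * α ^ (-s.re) := by
  obtain ⟨C1, hC1, h1⟩ := B1 n
  obtain ⟨C2, hC2, h2⟩ := Gamma_lower (-n) n
  obtain ⟨C3, hC3, h3⟩ := chi_bounds (-n) n
  have hpi := Real.pi_gt_three
  set N := 3 * n + 1 with hN
  refine ⟨C1 / C2 + C3 * (4^N * (2 * (N + 1))^N), by positivity, ?_⟩
  intro m M s α hn ht1 hM htα hα hm hm1
  have ht : 0 < s.im := by linarith
  have hM' : (1:ℝ) ≤ M := by exact_mod_cast hM
  have hα0 : 0 < α := by linarith
  set Y := 2 * π * ((M:ℝ) + 1/2) with hY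
  have hY0 : 0 < Y := by positivity
  have hab := abs_le.1 (le_refl |s.re|)
  have hre1 : -(n:ℝ) ≤ s.re := by linarith [hab.1]
  have hre2 : s.re ≤ n := by linarith [hab.2]
  have hg := h2 s hre1 hre2 ht1
  have hx := (h3 s hre1 hre2 ht1).1
  have hb := h1 m M s α Y (by rw [abs_le]; constructor <;> linarith [hab.1, hab.2]) ht1 hM hY htα hα hm hm1
  have hsum : 2 * π * I * ∑ v ∈ Finset.Icc 1 M, (2 * π * I * v : ℂ) ^ (s - 1)
      = chi s * (1 + Complex.exp (π * I * s)) * Complex.Gamma s * ∑ v ∈ Finset.Icc 1 M, (v : ℂ) ^ (-(1 - s)) := by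
    rw [Finset.mul_sum, Finset.mul_sum]
    refine Finset.sum_congr rfl fun v hv => pole_term ht.ne' v (Finset.mem_Icc.1 hv).1
  rw [hsum] at hb
  set Z := riemannZeta s - ∑ k ∈ Finset.Icc 1 m, (k:ℂ) ^ (-s) with hZ
  set S := ∑ v ∈ Finset.Icc 1 M, (v : ℂ) ^ (-(1 - s)) with hS
  have e1 : Complex.Gamma s * Z - chi s * (1 + Complex.exp (π * I * s)) * Complex.Gamma s * S
      = Complex.Gamma s * (Z - chi s * (1 + Complex.exp (π * I * s)) * S) := by ring
  rw [e1, norm_mul] at hb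
  set E := Real.exp (-(π/2) * s.im) with hE
  have hE0 : 0 < E := Real.exp_pos _
  have hασ : 0 < α ^ (-s.re) := by positivity
  have hmain : ‖Z - chi s * (1 + Complex.exp (π * I * s)) * S‖ ≤ C1 / C2 * α ^ (-s.re) := by
    set W := ‖Z - chi s * (1 + Complex.exp (π * I * s)) * S‖ with hW
    have hR : 0 < s.im ^ (s.re - 1/2) := by positivity
    have k1 : C2 * s.im ^ (s.re - 1/2) * E * W ≤ C1 * (Y ^ s.re * s.im ^ (-(1/2) : ℝ) * E) :=
      (mul_le_mul_of_nonneg_right hg (norm_nonneg _)).trans hb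
    have k2 : Y ^ s.re * s.im ^ (-(1/2) : ℝ) = α ^ (-s.re) * s.im ^ (s.re - 1/2) := by
      have : Y = s.im / α := by rw [htα]; field_simp
      rw [this, Real.div_rpow ht.le hα0.le, Real.rpow_neg hα0.le, sub_eq_add_neg, Real.rpow_add ht]
      ring
    rw [k2] at k1
    have hp : 0 < C2 * s.im ^ (s.re - 1/2) * E := by positivity
    apply le_of_mul_le_mul_left _ hp
    calc _ ≤ _ := k1
      _ = _ := by field_simp
  have hSb : ‖S‖ ≤ (1 + 2 * s.im)^(n+1) := by
    have hMt : (M:ℝ) ≤ 1 + 2 * s.im := by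
      have : (M:ℝ) ≤ Y := by rw [hY]; nlinarith
      have : Y ≤ 2 * s.im := by rw [htα]; nlinarith
      linarith
    calc ‖S‖ ≤ ∑ v ∈ Finset.Icc 1 M, (1 + 2 * s.im)^n := by
          refine norm_sum_le_of_le _ fun v hv => ?_
          have hv' := Finset.mem_Icc.1 hv
          have hv1 : (1:ℝ) ≤ v := by exact_mod_cast hv'.1
          have hvM : (v:ℝ) ≤ M := by exact_mod_cast hv'.2
          rw [Complex.norm_natCast_cpow_of_pos (by omega)]
          calc (v:ℝ) ^ (-(1-s)).re ≤ (v:ℝ)^(n:ℝ) := Real.rpow_le_rpow_of_exponent_le hv1 (by simp; linarith)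
            _ = (v:ℝ)^n := Real.rpow_natCast _ _
            _ ≤ _ := by gcongr; linarith
      _ = M * (1 + 2 * s.im)^n := by simp
      _ ≤ (1 + 2 * s.im) * (1 + 2 * s.im)^n := by gcongr
      _ = _ := by ring
  have hR : s.im^(1/2 - s.re) ≤ (1 + 2 * s.im)^n := by
    calc s.im^(1/2 - s.re) ≤ s.im^(n:ℝ) := Real.rpow_le_rpow_of_exponent_le ht1 (by linarith [hab.1])
      _ = s.im^n := Real.rpow_natCast _ _
      _ ≤ _ := by gcongr; linarith
  have hA : 1 ≤ (1 + 2 * s.im)^n * α ^ (-s.re) := by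
    have hαt : α ≤ s.im := by
      have : 1 ≤ Y := by rw [hY]; nlinarith
      rw [htα]; nlinarith
    have := rpow_ratio_bound (K := 2 * s.im) (x := 1) (y := α) (r := -s.re) (by linarith) one_pos hα0 (by nlinarith) (by linarith)
    rw [Real.one_rpow] at this
    refine this.trans ?_
    gcongr
    rw [← Real.rpow_natCast, abs_neg]
    calc (2 * s.im)^|s.re| ≤ (1 + 2*s.im)^|s.re| := by gcongr; linarith
      _ ≤ _ := Real.rpow_le_rpow_of_exponent_le (by linarith) (by linarith)
  have hexp := exp_poly N ht
  have herr : ‖chi s * Complex.exp (π * I * s) * S‖ ≤ C3 * (4^N * (2 * (N + 1))^N) * α ^ (-s.re) := by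
    rw [norm_mul, norm_mul, exp_pi_norm]
    calc _ ≤ (C3 * (1 + 2 * s.im)^n) * Real.exp (-(π * s.im)) * (1 + 2 * s.im)^(n+1) := by
          gcongr
          exact hx.trans (by gcongr)
      _ = (C3 * (1 + 2 * s.im)^n) * Real.exp (-(π * s.im)) * (1 + 2 * s.im)^(n+1) * 1 := by ring
      _ ≤ (C3 * (1 + 2 * s.im)^n) * Real.exp (-(π * s.im)) * (1 + 2 * s.im)^(n+1) * ((1 + 2 * s.im)^n * α ^ (-s.re)) := by gcongr
      _ = C3 * ((1 + 2 * s.im)^N * Real.exp (-(π * s.im))) * α ^ (-s.re) := by rw [hN]; ring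
      _ ≤ _ := by gcongr
  have e2 : Z - chi s * S = (Z - chi s * (1 + Complex.exp (π * I * s)) * S) + chi s * Complex.exp (π * I * s) * S := by ring
  rw [e2]
  refine (norm_add_le _ _).trans ?_
  linarith

lemma one_diff {a b : ℕ} {α c : ℝ} {s : ℂ} (hα : 1 ≤ α) (hab : a ≤ b) (hb : b ≤ a + 1)
    (h1 : (b:ℝ) ≤ 2 * α) (h2 : α ≤ 2 * ((a:ℝ) + 1)) (hc : |s.re| ≤ c) :
    ‖∑ k ∈ Finset.Icc 1 b, (k:ℂ) ^ (-s) - ∑ k ∈ Finset.Icc 1 a, (k:ℂ) ^ (-s)‖ ≤ 2^c * α^(-s.re) := by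
  have hp : 0 < α^(-s.re) := by positivity
  rcases hab.eq_or_lt with h | h
  · subst h; simp; positivity
  · have hb' : b = a + 1 := by omega
    subst hb'
    rw [Finset.sum_Icc_succ_top (by omega), add_sub_cancel_left, Complex.norm_natCast_cpow_of_pos (by omega)]
    have := rpow_ratio_bound (K := 2) (x := ((a+1:ℕ):ℝ)) (y := α) (r := -s.re) (by norm_num) (by positivity) (by linarith) h1 (by push_cast; exact h2)
    rw [Complex.neg_re]
    refine this.trans ?_
    gcongr
    · norm_num
    · rw [abs_neg]; exact hc

lemma Core2 (n : ℕ) : ∃ C > 0, ∀ (s : ℂ) (α β : ℝ), |s.re| + 1 ≤ n → 2 * π ≤ s.im → 1 ≤ α → α ≤ β → s.im = 2 * π * α * β →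
    ‖riemannZeta s - zetaSum α s - chi s * zetaSum β (1 - s)‖ ≤ C * α ^ (-s.re) := by
  obtain ⟨C1, hC1, h1⟩ := Core1 n
  have hpi := Real.pi_gt_three
  refine ⟨(C1 + 1) * 2^(n:ℝ), by positivity, ?_⟩
  intro s α β hn ht hα hαβ htα
  set M := ⌊β⌋₊ with hM
  have hM1 : 1 ≤ M := Nat.le_floor (by push_cast; linarith)
  have hM1' : (1:ℝ) ≤ M := by exact_mod_cast hM1
  have hMb : (M:ℝ) ≤ β := Nat.floor_le (by linarith)
  have hMb' : β < M + 1 := Nat.lt_floor_add_one β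
  set α' := α * β / (M + 1/2) with hα'
  have hMp : 0 < (M:ℝ) + 1/2 := by linarith
  have hα'e : α' * (M + 1/2) = α * β := by rw [hα']; field_simp
  have g1 : 2 * α ≤ 3 * α' := by
    rw [hα', mul_div_assoc', le_div_iff₀ hMp]; nlinarith
  have g2 : 3 * α' ≤ 4 * α := by
    rw [hα', mul_div_assoc', div_le_iff₀ hMp]; nlinarith
  have g3 : α' < α + 1 := by
    rw [hα', div_lt_iff₀ hMp]; nlinarith
  have g4 : α < α' + 1 := by
    by_contra h
    push Not at h
    nlinarith
  set m := ⌊α'⌋₊ with hm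
  have hm1 : (m:ℝ) ≤ α' := Nat.floor_le (by linarith)
  have hm2 : α' < m + 1 := Nat.lt_floor_add_one _
  have hc := h1 m M s α' hn (by linarith) hM1 (by rw [htα]; linear_combination (-2 * π) * hα'e) (by linarith) hm1 hm2
  set a := ⌊α⌋₊ with ha
  have ha1 : (a:ℝ) ≤ α := Nat.floor_le (by linarith)
  have ha2 : α < a + 1 := Nat.lt_floor_add_one _
  have hpw : α'^(-s.re) ≤ 2^(n:ℝ) * α^(-s.re) := by
    refine (rpow_ratio_bound (K := 2) (x := α') (y := α) (r := -s.re) (by norm_num) (by linarith) (by linarith) (by linarith) (by linarith)).trans ?_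
    have hp : 0 < α^(-s.re) := by positivity
    gcongr
    · norm_num
    · rw [abs_neg]; linarith
  have hdiff : ‖∑ k ∈ Finset.Icc 1 m, (k:ℂ) ^ (-s) - ∑ k ∈ Finset.Icc 1 a, (k:ℂ) ^ (-s)‖ ≤ 2^(n:ℝ) * α^(-s.re) := by
    rcases le_total a m with h | h
    · refine one_diff hα h ?_ (by linarith) (by linarith) (by linarith)
      · have : (m:ℝ) < a + 2 := by linarith
        have : m < a + 2 := by exact_mod_cast this
        omega
    · rw [norm_sub_rev]
      refine one_diff hα h ?_ (by linarith) (by linarith) (by linarith)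
      · have : (a:ℝ) < m + 2 := by linarith
        have : a < m + 2 := by exact_mod_cast this
        omega
  unfold zetaSum
  rw [← hM, ← ha]
  have e : riemannZeta s - ∑ k ∈ Finset.Icc 1 a, (k:ℂ) ^ (-s) - chi s * ∑ v ∈ Finset.Icc 1 M, (v : ℂ) ^ (-(1 - s))
     = (riemannZeta s - ∑ k ∈ Finset.Icc 1 m, (k:ℂ) ^ (-s) - chi s * ∑ v ∈ Finset.Icc 1 M, (v : ℂ) ^ (-(1 - s)))
       + (∑ k ∈ Finset.Icc 1 m, (k:ℂ) ^ (-s) - ∑ k ∈ Finset.Icc 1 a, (k:ℂ) ^ (-s)) := by ring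
  rw [e]
  refine (norm_add_le _ _).trans ?_
  have := mul_le_mul_of_nonneg_left hpw hC1.le
  linarith



lemma theta_refl {ϑ : ℂ → ℂ} (hϑ : IsRSTheta ϑ) {s : ℂ} (ht : 0 < s.im) :
    Complex.exp (I * ϑ s) * Complex.exp (I * ϑ (1 - s)) = 1 := by
  obtain ⟨hd, he, h0⟩ := hϑ
  set p : ℝ → ℂ := fun τ => 1/2 + τ * (s - 1/2) with hp
  have hpc : Continuous p := by rw [hp]; fun_prop
  have hpm : ∀ τ ∈ Set.Icc (0:ℝ) 1, p τ ∈ RSOmega := by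
    intro τ hτ
    rcases hτ.1.eq_or_lt with h | h
    · right; simp [hp, ← h]; norm_num
    · left; simp [hp]; exact ⟨h.ne', ht.ne'⟩
  have hc1 : ContinuousOn (fun τ => ϑ (p τ)) (Set.Icc (0:ℝ) 1) :=
    hd.continuousOn.comp hpc.continuousOn hpm
  have hc2 : ContinuousOn (fun τ => ϑ (1 - p τ)) (Set.Icc (0:ℝ) 1) :=
    hd.continuousOn.comp (by fun_prop) (fun τ hτ => RS_one_sub (hpm τ hτ))
  set g : ℝ → ℂ := fun τ => Complex.exp (I * (ϑ (p τ) + ϑ (1 - p τ))) with hg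
  have hgc : ContinuousOn g (Set.Icc (0:ℝ) 1) :=
    Complex.continuous_exp.comp_continuousOn (continuousOn_const.mul (hc1.add hc2))
  have hsq : ∀ τ ∈ Set.Icc (0:ℝ) 1, g τ ^ 2 = 1 := by
    intro τ hτ
    have e1 := he _ (hpm τ hτ)
    have e2 := he _ (RS_one_sub (hpm τ hτ))
    have e3 := chi_mul (hpm τ hτ)
    rw [← e1, ← e2, ← Complex.exp_add] at e3
    have : g τ ^ 2 = (Complex.exp (-2 * I * ϑ (p τ) + -2 * I * ϑ (1 - p τ)))⁻¹ := by
      rw [hg, ← Complex.exp_neg]; simp only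
      rw [← Complex.exp_nat_mul]; congr 1; push_cast; ring
    rw [this, e3, inv_one]
  have hg0 : g 0 = 1 := by
    have e : (1 - 1/2 : ℂ) = 1/2 := by norm_num
    simp only [hg, hp, Complex.ofReal_zero, zero_mul, add_zero, e, h0]
    simp
  have hfin : g 1 = 1 := by
    refine isPreconnected_Icc.eq_of_sq_eq (S := Set.Icc (0:ℝ) 1) (g := fun _ => 1) hgc continuousOn_const ?_ ?_
      (Set.left_mem_Icc.2 zero_le_one) hg0 (Set.right_mem_Icc.2 zero_le_one)
    · intro τ hτ
      simpa using hsq τ hτ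
    · intro τ _; exact one_ne_zero
  have hp1 : p 1 = s := by simp [hp]
  simp only [hg, hp1] at hfin
  rw [← Complex.exp_add, ← mul_add]
  exact hfin

lemma pow_alpha {α β t r : ℝ} (hα : 0 < α) (hβ : 0 < β) (ht : t = 2 * π * α * β) :
    α ^ r = (√(α/β))^r * t^(r/2) * (2*π)^(-r/2) := by
  have hpi := Real.pi_pos
  have htp : 0 < t := by rw [ht]; positivity
  have hs : 0 < √(α/β) := by positivity
  rw [Real.rpow_def_of_pos hα, Real.rpow_def_of_pos hs, Real.rpow_def_of_pos htp, Real.rpow_def_of_pos (by positivity),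
    ← Real.exp_add, ← Real.exp_add, Real.log_sqrt (by positivity), Real.log_div hα.ne' hβ.ne', ht,
    Real.log_mul (by positivity) hβ.ne', Real.log_mul (by positivity) hα.ne']
  congr 1; ring

lemma pow_beta {α β t r : ℝ} (hα : 0 < α) (hβ : 0 < β) (ht : t = 2 * π * α * β) :
    β ^ r = (√(α/β))^(-r) * t^(r/2) * (2*π)^(-r/2) := by
  have hpi := Real.pi_pos
  have htp : 0 < t := by rw [ht]; positivity
  have hs : 0 < √(α/β) := by positivity
  rw [Real.rpow_def_of_pos hβ, Real.rpow_def_of_pos hs, Real.rpow_def_of_pos htp, Real.rpow_def_of_pos (by positivity),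
    ← Real.exp_add, ← Real.exp_add, Real.log_sqrt (by positivity), Real.log_div hα.ne' hβ.ne', ht,
    Real.log_mul (by positivity) hβ.ne', Real.log_mul (by positivity) hα.ne']
  congr 1; ring

open ComplexConjugate in
lemma nat_cpow_conj (k : ℕ) (s : ℂ) : (k:ℂ) ^ (conj s) = conj ((k:ℂ)^s) := by
  rw [Complex.cpow_conj _ _ (by rw [Complex.natCast_arg]; exact Real.pi_pos.ne)]
  simp

open ComplexConjugate in
lemma zetaSum_conj (x : ℝ) (s : ℂ) : zetaSum x (conj s) = conj (zetaSum x s) := by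
  unfold zetaSum
  rw [map_sum]
  refine Finset.sum_congr rfl fun k _ => ?_
  rw [← nat_cpow_conj, map_neg]

open ComplexConjugate in
lemma chi_conj (s : ℂ) : chi (conj s) = conj (chi s) := by
  unfold chi
  rw [map_div₀, map_mul, ← Complex.Gamma_conj, ← Complex.Gamma_conj]
  have h2 : conj (2:ℂ) = 2 := Complex.conj_ofNat 2
  have h : ((π:ℂ)) ^ (conj s - 1/2) = conj ((π:ℂ)^(s - 1/2)) := by
    have := Complex.cpow_conj (π:ℂ) (s - 1/2) (by rw [Complex.arg_ofReal_of_nonneg Real.pi_pos.le]; exact Real.pi_pos.ne)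
    rw [map_sub, map_div₀, map_one, h2, Complex.conj_ofReal] at this
    exact this
  rw [h, map_div₀, map_div₀, map_sub, map_one, h2]

open ComplexConjugate in
lemma err_conj {s : ℂ} (ht : s.im ≠ 0) (α β : ℝ) :
    ‖riemannZeta s - zetaSum α s - chi s * zetaSum β (1 - s)‖ =
    ‖chi s‖ * ‖riemannZeta (1 - conj s) - zetaSum β (1 - conj s) - chi (1 - conj s) * zetaSum α (1 - (1 - conj s))‖ := by
  have h := chi_mul (s := s) (Or.inl ht)
  have e : riemannZeta s - zetaSum α s - chi s * zetaSum β (1 - s) =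
     chi s * (riemannZeta (1 - s) - zetaSum β (1 - s) - chi (1 - s) * zetaSum α s) := by
    rw [zeta_fe ht]; linear_combination (zetaSum α s) * h
  rw [e, norm_mul]
  congr 1
  rw [sub_sub_cancel, show 1 - conj s = conj (1 - s) by simp, riemannZeta_conj, zetaSum_conj, zetaSum_conj, chi_conj,
    ← map_mul, ← map_sub, ← map_sub, Complex.norm_conj]

theorem statement1 (A B : ℝ) (ϑ : ℂ → ℂ) (hϑ : IsRSTheta ϑ) :
    ∃ C : ℝ, ∀ s : ℂ, s.re ∈ Set.Icc A B → 2 * π ≤ s.im →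
      ∀ α β : ℝ, 1 ≤ α → 1 ≤ β → s.im = 2 * π * α * β →
        ‖Complex.exp (I * ϑ s) * riemannZeta s
            - Complex.exp (I * ϑ s) * zetaSum α s
            - Complex.exp (I * ϑ (1 - s)) * zetaSum β (1 - s)‖ ≤
          C * (Real.sqrt (α / β)) ^ ((1:ℝ)/2 - s.re) *
            ((Real.sqrt (α / β)) ^ ((1:ℝ)/2) + (Real.sqrt (α / β)) ^ (-(1:ℝ)/2)) *
            s.im ^ (-(1:ℝ)/4) := by
  obtain ⟨n, hn⟩ := exists_nat_ge (|A| + |B| + 2)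
  obtain ⟨C1, hC1, h1⟩ := Core2 n
  obtain ⟨C2, hC2, h2⟩ := chi_bounds (-n) n
  have hpi := Real.pi_gt_three
  refine ⟨√C2 * C1 * (2*π)^(n:ℝ), fun s hs ht α β hα hβ htα => ?_⟩
  have hσ : |s.re| ≤ |A| + |B| := by
    rw [abs_le]
    constructor
    · linarith [hs.1, neg_abs_le A, abs_nonneg B]
    · linarith [hs.2, le_abs_self B, abs_nonneg A]
  have hσ' := abs_le.1 hσ
  have ht0 : 0 < s.im := by linarith
  have hα0 : 0 < α := by linarith
  have hβ0 : 0 < β := by linarith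
  have hrefl := theta_refl hϑ ht0
  have hchi := hϑ.2.1 s (Or.inl ht0.ne')
  set e := Complex.exp (I * ϑ s) with he
  have he0 : e ≠ 0 := Complex.exp_ne_zero _
  have hchi2 : e^2 * chi s = 1 := by
    rw [← hchi, he, ← Complex.exp_nat_mul, ← Complex.exp_add, ← Complex.exp_zero]
    congr 1; push_cast; ring
  have hr2 : Complex.exp (I * ϑ (1 - s)) = e * chi s := by
    apply mul_left_cancel₀ he0
    rw [hrefl, ← hchi2]; ring
  have hF : e * riemannZeta s - e * zetaSum α s - Complex.exp (I * ϑ (1 - s)) * zetaSum β (1 - s)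
      = e * (riemannZeta s - zetaSum α s - chi s * zetaSum β (1 - s)) := by rw [hr2]; ring
  rw [hF, norm_mul]
  obtain ⟨hb1, hb2⟩ := h2 s (by linarith) (by linarith) (by linarith)
  have hy : ‖e‖^2 * ‖chi s‖ = 1 := by rw [← norm_pow, ← norm_mul, hchi2, norm_one]
  have hy0 : 0 < ‖e‖ := norm_pos_iff.2 he0
  have hsqC : √C2^2 = C2 := Real.sq_sqrt hC2.le
  have hsp := rpow_split (σ := s.re) ht0
  have hsq1 : ∀ r : ℝ, (s.im^(r/2))^2 = s.im^r := by
    intro r; rw [← Real.rpow_natCast, ← Real.rpow_mul ht0.le]; congr 1; push_cast; ring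
  set lam := √(α/β) with hlam
  have hl0 : 0 < lam := by positivity
  have h2pi : ∀ r : ℝ, r ≤ n → (2*π)^r ≤ (2*π)^(n:ℝ) := fun r hr => Real.rpow_le_rpow_of_exponent_le (by linarith) hr
  have hlp1 : lam ^ ((1:ℝ)/2 - s.re) * lam ^ (-(1:ℝ)/2) = lam ^ (-s.re) := by
    rw [← Real.rpow_add hl0]; congr 1; ring
  have hlp2 : lam ^ ((1:ℝ)/2 - s.re) * lam ^ ((1:ℝ)/2) = lam ^ (1-s.re) := by
    rw [← Real.rpow_add hl0]; congr 1; ring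
  have hgoal : √C2 * C1 * (2*π)^(n:ℝ) * lam ^ ((1:ℝ)/2 - s.re) * (lam ^ ((1:ℝ)/2) + lam ^ (-(1:ℝ)/2)) * s.im ^ (-(1:ℝ)/4)
      = √C2 * C1 * (2*π)^(n:ℝ) * (lam ^ (1-s.re) + lam ^ (-s.re)) * s.im ^ (-(1:ℝ)/4) := by
    rw [← hlp1, ← hlp2]; ring
  rw [hgoal]
  have q1 : 0 < lam ^ (1-s.re) := by positivity
  have q2 : 0 < lam ^ (-s.re) := by positivity
  have q3 : 0 < s.im ^ (-(1:ℝ)/4) := by positivity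
  rcases le_total α β with hab | hab
  · have hE := h1 s α β (by linarith) ht hα hab htα
    have hyb : ‖e‖ ≤ √C2 * s.im^((s.re - 1/2)/2) := by
      refine (sq_le_sq₀ (by positivity) (by positivity)).1 ?_
      rw [mul_pow, hsqC, hsq1]
      have hR' : 0 < s.im^(s.re - 1/2) := by positivity
      have := mul_le_mul_of_nonneg_left hb2 (by positivity : 0 ≤ ‖e‖^2 * s.im^(s.re - 1/2))
      calc ‖e‖^2 = ‖e‖^2 * s.im^(s.re - 1/2) * s.im^(1/2 - s.re) := by linear_combination (-‖e‖^2) * hsp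
        _ ≤ _ := this
        _ = C2 * s.im^(s.re - 1/2) := by linear_combination (C2 * s.im^(s.re - 1/2)) * hy
    rw [pow_alpha hα0 hβ0 htα, ← hlam] at hE
    have hpp : s.im^((s.re - 1/2)/2) * s.im^(-s.re/2) = s.im ^ (-(1:ℝ)/4) := by
      rw [← Real.rpow_add ht0]; congr 1; ring
    calc _ ≤ (√C2 * s.im^((s.re - 1/2)/2)) * (C1 * (lam^(-s.re) * s.im^(-s.re/2) * (2*π)^(- -s.re/2))) := by gcongr
      _ = √C2 * C1 * (2*π)^(- -s.re/2) * lam^(-s.re) * (s.im^((s.re - 1/2)/2) * s.im^(-s.re/2)) := by ring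
      _ = √C2 * C1 * (2*π)^(- -s.re/2) * lam^(-s.re) * s.im ^ (-(1:ℝ)/4) := by rw [hpp]
      _ ≤ _ := by
        gcongr
        · linarith
        · linarith
        · linarith
  · rw [err_conj ht0.ne']
    have hE := h1 (1 - (starRingEnd ℂ) s) β α
      (by
        have : (1 - (starRingEnd ℂ) s).re = 1 - s.re := by simp
        rw [this]
        have := abs_sub (1:ℝ) s.re
        rw [abs_one] at this
        linarith) (by simpa using ht) hβ hab (by simp; rw [htα]; ring)
    have er : (-(1 - (starRingEnd ℂ) s).re) = s.re - 1 := by simp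
    rw [er, pow_beta hα0 hβ0 htα, ← hlam] at hE
    have hyb : ‖e‖ * ‖chi s‖ ≤ √C2 * s.im^((1/2 - s.re)/2) := by
      refine (sq_le_sq₀ (by positivity) (by positivity)).1 ?_
      rw [mul_pow, mul_pow, hsqC, hsq1]
      calc ‖e‖^2 * ‖chi s‖^2 = ‖chi s‖ := by linear_combination ‖chi s‖ * hy
        _ ≤ _ := hb1
    have hpp : s.im^((1/2 - s.re)/2) * s.im^((s.re - 1)/2) = s.im ^ (-(1:ℝ)/4) := by
      rw [← Real.rpow_add ht0]; congr 1; ring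
    rw [← mul_assoc]
    calc _ ≤ (√C2 * s.im^((1/2 - s.re)/2)) * (C1 * (lam^(-(s.re - 1)) * s.im^((s.re - 1)/2) * (2*π)^(-(s.re - 1)/2))) := by gcongr
      _ = √C2 * C1 * (2*π)^(-(s.re - 1)/2) * lam^(-(s.re - 1)) * (s.im^((1/2 - s.re)/2) * s.im^((s.re - 1)/2)) := by ring
      _ = √C2 * C1 * (2*π)^(-(s.re - 1)/2) * lam^(1 - s.re) * s.im ^ (-(1:ℝ)/4) := by rw [hpp, neg_sub]
      _ ≤ _ := by
        gcongr
        · linarith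
        · linarith
        · linarith


end
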